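/- Let 𝓗, P₁, P₀, S, Λ, Θ, n₊, n₋, G₁, G₂, pr₊, pr₋, A be as in the semi-axis boundary-system setting (I = [0, ∞), 𝓗 essentially bounded). Then a linear operator H with −A ⊆ H ⊆ A* (so −Hx = P₁(𝓗x)' + P₀𝓗x on D(H) ⊇ D(A)) is maximal dissipative in L²_𝓗(0, ∞) — equivalently, by the Lumer–Phillips theorem, H generates a C₀-semigroup of contractions — if and only if there exists a linear contraction T : G₂ → G₁ (i.e., (Tz)*Λ(Tz) ≤ z*Θz for all z ∈ ℂ^{n₋}) such that D(H) = {x ∈ L²_𝓗(0, ∞) : (𝓗x)' ∈ L²_𝓗(0, ∞) and T pr₋(S(𝓗x)(0)) = pr₊(S(𝓗x)(0))}. -/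

import Mathlib

open MeasureTheory Matrix

/-- The (possibly infinite / junk-valued) weighted inner product
`⟨x, y⟩_{L²_𝓗(I)} = ∫_I x(ξ)* 𝓗(ξ) y(ξ) dξ` of two `ℂ^d`-valued functions. -/
noncomputable def wip (d : ℕ) (𝓗 : ℝ → Matrix (Fin d) (Fin d) ℂ) (I : Set ℝ)
    (x y : ℝ → Fin d → ℂ) : ℂ :=
  ∫ ξ in I, star (x ξ) ⬝ᵥ ((𝓗 ξ) *ᵥ (y ξ))

/-- Membership in the weighted space `L²_𝓗(I)`: `x` is a.e. measurable on `I` and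
`∫_I x(ξ)* 𝓗(ξ) x(ξ) dξ < ∞`. -/
def MemL2w (d : ℕ) (𝓗 : ℝ → Matrix (Fin d) (Fin d) ℂ) (I : Set ℝ)
    (x : ℝ → Fin d → ℂ) : Prop :=
  AEStronglyMeasurable x (volume.restrict I) ∧
    Integrable (fun ξ => (star (x ξ) ⬝ᵥ ((𝓗 ξ) *ᵥ (x ξ))).re) (volume.restrict I)

/-- `u` is the locally absolutely continuous representative of `𝓗x` on `[0, ∞)`
(the indefinite integral of `g`, the a.e. derivative `(𝓗x)'`), with `g ∈ L²_𝓗(0, ∞)`. -/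
def RepSemi (d : ℕ) (𝓗 : ℝ → Matrix (Fin d) (Fin d) ℂ)
    (x u g : ℝ → Fin d → ℂ) : Prop :=
  (∀ᵐ ξ ∂(volume.restrict (Set.Ioi 0)), u ξ = (𝓗 ξ) *ᵥ (x ξ)) ∧
    (∀ ξ ∈ Set.Ici (0 : ℝ), u ξ = u 0 + ∫ τ in (0 : ℝ)..ξ, g τ) ∧
    MemL2w d 𝓗 (Set.Ioi 0) g

/-- Graph of the minimal operator `A x = P₁(𝓗x)' + P₀𝓗x`,
`D(A) = {x : (𝓗x)' ∈ L²_𝓗, (𝓗x)(0) = 0}`. -/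
def GraphASemi (d : ℕ) (𝓗 : ℝ → Matrix (Fin d) (Fin d) ℂ)
    (P1 P0 : Matrix (Fin d) (Fin d) ℂ) (x y : ℝ → Fin d → ℂ) : Prop :=
  MemL2w d 𝓗 (Set.Ioi 0) x ∧ MemL2w d 𝓗 (Set.Ioi 0) y ∧
    ∃ u g, RepSemi d 𝓗 x u g ∧ u 0 = 0 ∧
      (∀ᵐ ξ ∂(volume.restrict (Set.Ioi 0)), y ξ = P1 *ᵥ (g ξ) + P0 *ᵥ (u ξ))

/-- Graph of the adjoint `A* x = −P₁(𝓗x)' − P₀𝓗x`, `D(A*) = {x : (𝓗x)' ∈ L²_𝓗}`. -/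
def GraphAstarSemi (d : ℕ) (𝓗 : ℝ → Matrix (Fin d) (Fin d) ℂ)
    (P1 P0 : Matrix (Fin d) (Fin d) ℂ) (x y : ℝ → Fin d → ℂ) : Prop :=
  MemL2w d 𝓗 (Set.Ioi 0) x ∧ MemL2w d 𝓗 (Set.Ioi 0) y ∧
    ∃ u g, RepSemi d 𝓗 x u g ∧
      (∀ᵐ ξ ∂(volume.restrict (Set.Ioi 0)), y ξ = -(P1 *ᵥ (g ξ)) - P0 *ᵥ (u ξ))

/-- A relation on (equivalence classes of) functions is a *linear operator* in `L²_𝓗(0,∞)`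
if it only relates members of `L²_𝓗`, is invariant under a.e. equality, is closed under
addition and scalar multiplication, and is single valued up to a.e. equality. -/
def IsOpRel (d : ℕ) (𝓗 : ℝ → Matrix (Fin d) (Fin d) ℂ)
    (R : (ℝ → Fin d → ℂ) → (ℝ → Fin d → ℂ) → Prop) : Prop :=
  (∀ x y, R x y → MemL2w d 𝓗 (Set.Ioi 0) x ∧ MemL2w d 𝓗 (Set.Ioi 0) y) ∧
    (∀ x y x' y', R x y → x' =ᵐ[volume.restrict (Set.Ioi 0)] x →
      y' =ᵐ[volume.restrict (Set.Ioi 0)] y → R x' y') ∧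
    (∀ x y x' y', R x y → R x' y' → R (fun ξ => x ξ + x' ξ) (fun ξ => y ξ + y' ξ)) ∧
    (∀ (c : ℂ) x y, R x y → R (fun ξ => c • x ξ) (fun ξ => c • y ξ)) ∧
    (∀ x y y', R x y → R x y' → y =ᵐ[volume.restrict (Set.Ioi 0)] y')

/-- Dissipativity of an operator (relation) `R` in `L²_𝓗(0, ∞)`:
`Re ⟨H x, x⟩_{L²_𝓗} ≤ 0` for all pairs `(x, H x)`. -/
def DissipRel (d : ℕ) (𝓗 : ℝ → Matrix (Fin d) (Fin d) ℂ)
    (R : (ℝ → Fin d → ℂ) → (ℝ → Fin d → ℂ) → Prop) : Prop :=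
  ∀ x y, R x y → (wip d 𝓗 (Set.Ioi 0) y x).re ≤ 0

/-- Maximal dissipativity: `R` is dissipative and every dissipative operator (relation)
extending `R` coincides with `R`. -/
def MaxDissipRel (d : ℕ) (𝓗 : ℝ → Matrix (Fin d) (Fin d) ℂ)
    (R : (ℝ → Fin d → ℂ) → (ℝ → Fin d → ℂ) → Prop) : Prop :=
  DissipRel d 𝓗 R ∧
    ∀ K, IsOpRel d 𝓗 K → DissipRel d 𝓗 K →
      (∀ x y, R x y → K x y) → ∀ x y, K x y → R x y

/-- Projection onto the first `n₊` coordinates. -/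
def prPlus (np nm : ℕ) (v : Fin (np + nm) → ℂ) : Fin np → ℂ := fun i => v (Fin.castAdd nm i)

/-- Projection onto the last `n₋` coordinates. -/
def prMinus (np nm : ℕ) (v : Fin (np + nm) → ℂ) : Fin nm → ℂ := fun j => v (Fin.natAdd np j)

lemma integral_deriv_mul_real {f' g' : ℝ → ℝ} {a b : ℝ}
    (hf : IntervalIntegrable f' volume a b) (hg : IntervalIntegrable g' volume a b) (c e : ℝ) :
    ∫ x in a..b, (f' x * (e + ∫ t in a..x, g' t) + (c + ∫ t in a..x, f' t) * g' x)
      = (c + ∫ t in a..b, f' t) * (e + ∫ t in a..b, g' t) - c * e := by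
  have ac : ∀ {k : ℝ → ℝ} (z : ℝ), IntervalIntegrable k volume a b →
      AbsolutelyContinuousOnInterval (fun x => z + ∫ t in a..x, k t) a b := by
    intro k z hk
    refine AbsolutelyContinuousOnInterval.fun_add ?_
      (hk.absolutelyContinuousOnInterval_intervalIntegral (c := a) (by simp))
    exact (LipschitzWith.const z).lipschitzOnWith.absolutelyContinuousOnInterval
  have h := AbsolutelyContinuousOnInterval.integral_deriv_mul_eq_sub (ac c hf) (ac e hg)
  simp only [intervalIntegral.integral_same, add_zero] at h
  rw [← h]
  apply intervalIntegral.integral_congr_ae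
  filter_upwards [hf.ae_hasDerivAt_integral, hg.ae_hasDerivAt_integral] with x h1 h2 hx
  have hx' := Set.uIoc_subset_uIcc hx
  rw [((h1 hx' a (by simp)).const_add c).deriv, ((h2 hx' a (by simp)).const_add e).deriv]

lemma intervalIntegrable_primitive_mul {f g : ℝ → ℂ} {a b : ℝ}
    (hf : IntervalIntegrable f volume a b) (hg : IntervalIntegrable g volume a b) (c : ℂ) :
    IntervalIntegrable (fun x => (c + ∫ t in a..x, f t) * g x) volume a b := by
  refine hg.continuousOn_mul ?_
  exact continuousOn_const.add
    (intervalIntegral.continuousOn_primitive_interval' hf (by simp))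

lemma intervalIntegrable_primitive_mul_real {f g : ℝ → ℝ} {a b : ℝ}
    (hf : IntervalIntegrable f volume a b) (hg : IntervalIntegrable g volume a b) (c : ℝ) :
    IntervalIntegrable (fun x => (c + ∫ t in a..x, f t) * g x) volume a b := by
  refine hg.continuousOn_mul ?_
  exact continuousOn_const.add
    (intervalIntegral.continuousOn_primitive_interval' hf (by simp))

lemma integral_deriv_mul_complex {f' g' : ℝ → ℂ} {a b : ℝ}
    (hf : IntervalIntegrable f' volume a b) (hg : IntervalIntegrable g' volume a b) (c e : ℂ) :
    ∫ x in a..b, (f' x * (e + ∫ t in a..x, g' t) + (c + ∫ t in a..x, f' t) * g' x)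
      = (c + ∫ t in a..b, f' t) * (e + ∫ t in a..b, g' t) - c * e := by
  have cre : ∀ {k : ℝ → ℂ} {x : ℝ}, IntervalIntegrable k volume a x →
      (∫ t in a..x, k t).re = ∫ t in a..x, (k t).re := fun hk =>
    (Complex.reCLM.intervalIntegral_comp_comm hk).symm
  have cim : ∀ {k : ℝ → ℂ} {x : ℝ}, IntervalIntegrable k volume a x →
      (∫ t in a..x, k t).im = ∫ t in a..x, (k t).im := fun hk =>
    (Complex.imCLM.intervalIntegral_comp_comm hk).symm
  have sub : ∀ {k : ℝ → ℂ} {x : ℝ}, IntervalIntegrable k volume a b → x ∈ Set.uIcc a b →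
      IntervalIntegrable k volume a x := fun hk hx =>
    hk.mono_set (Set.uIcc_subset_uIcc Set.left_mem_uIcc hx)
  have hfr : IntervalIntegrable (fun x => (f' x).re) volume a b :=
    ⟨hf.1.re, hf.2.re⟩
  have hfi : IntervalIntegrable (fun x => (f' x).im) volume a b :=
    ⟨hf.1.im, hf.2.im⟩
  have hgr : IntervalIntegrable (fun x => (g' x).re) volume a b :=
    ⟨hg.1.re, hg.2.re⟩
  have hgi : IntervalIntegrable (fun x => (g' x).im) volume a b :=
    ⟨hg.1.im, hg.2.im⟩
  have key : ∀ {p q : ℝ → ℝ}, IntervalIntegrable p volume a b → IntervalIntegrable q volume a b →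
      ∀ c e : ℝ, IntervalIntegrable (fun x => p x * (e + ∫ t in a..x, q t) +
        (c + ∫ t in a..x, p t) * q x) volume a b := by
    intro p q hp hq c e
    refine IntervalIntegrable.add ?_ (intervalIntegrable_primitive_mul_real hp hq c)
    simpa only [mul_comm] using intervalIntegrable_primitive_mul_real hq hp e
  have hint : IntervalIntegrable (fun x => f' x * (e + ∫ t in a..x, g' t) +
      (c + ∫ t in a..x, f' t) * g' x) volume a b := by
    refine IntervalIntegrable.add ?_ (intervalIntegrable_primitive_mul hf hg c)
    simpa only [mul_comm] using intervalIntegrable_primitive_mul hg hf e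
  apply Complex.ext
  · rw [cre hint]
    have h1 := integral_deriv_mul_real hfr hgr c.re e.re
    have h2 := integral_deriv_mul_real hfi hgi c.im e.im
    have h3 : ∫ x in a..b, (f' x * (e + ∫ t in a..x, g' t) + (c + ∫ t in a..x, f' t) * g' x).re
        = (∫ x in a..b, ((f' x).re * (e.re + ∫ t in a..x, (g' t).re) +
            (c.re + ∫ t in a..x, (f' t).re) * (g' x).re)) -
          ∫ x in a..b, ((f' x).im * (e.im + ∫ t in a..x, (g' t).im) +
            (c.im + ∫ t in a..x, (f' t).im) * (g' x).im) := by
      rw [← intervalIntegral.integral_sub (key hfr hgr _ _) (key hfi hgi _ _)]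
      apply intervalIntegral.integral_congr
      intro x hx
      simp only [Complex.add_re, Complex.mul_re, Complex.add_im, cre (sub hf hx), cim (sub hf hx),
        cre (sub hg hx), cim (sub hg hx)]
      ring
    rw [h3, h1, h2]
    simp only [Complex.add_re, Complex.sub_re, Complex.mul_re, Complex.add_im, cre hf, cim hf,
      cre hg, cim hg]
    ring
  · rw [cim hint]
    have h1 := integral_deriv_mul_real hfr hgi c.re e.im
    have h2 := integral_deriv_mul_real hfi hgr c.im e.re
    have h3 : ∫ x in a..b, (f' x * (e + ∫ t in a..x, g' t) + (c + ∫ t in a..x, f' t) * g' x).im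
        = (∫ x in a..b, ((f' x).re * (e.im + ∫ t in a..x, (g' t).im) +
            (c.re + ∫ t in a..x, (f' t).re) * (g' x).im)) +
          ∫ x in a..b, ((f' x).im * (e.re + ∫ t in a..x, (g' t).re) +
            (c.im + ∫ t in a..x, (f' t).im) * (g' x).re) := by
      rw [← intervalIntegral.integral_add (key hfr hgi _ _) (key hfi hgr _ _)]
      apply intervalIntegral.integral_congr
      intro x hx
      simp only [Complex.add_re, Complex.mul_im, Complex.add_im, cre (sub hf hx), cim (sub hf hx),
        cre (sub hg hx), cim (sub hg hx)]
      ring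
    rw [h3, h1, h2]
    simp only [Complex.add_re, Complex.sub_im, Complex.mul_im, Complex.add_im, cre hf, cim hf,
      cre hg, cim hg]
    ring

/-- Integration by parts for the sesquilinear form induced by a matrix. -/
lemma integral_deriv_dotProduct {n : ℕ} (P : Matrix (Fin n) (Fin n) ℂ)
    {u g v h : ℝ → Fin n → ℂ} {a b : ℝ} (hab : a ≤ b)
    (hg : IntervalIntegrable g volume a b) (hh : IntervalIntegrable h volume a b)
    (hu : ∀ x ∈ Set.Icc a b, u x = u a + ∫ t in a..x, g t)
    (hv : ∀ x ∈ Set.Icc a b, v x = v a + ∫ t in a..x, h t) :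
    IntervalIntegrable (fun x => star (g x) ⬝ᵥ (P *ᵥ v x)) volume a b ∧
    IntervalIntegrable (fun x => star (u x) ⬝ᵥ (P *ᵥ h x)) volume a b ∧
    ∫ x in a..b, (star (g x) ⬝ᵥ (P *ᵥ v x) + star (u x) ⬝ᵥ (P *ᵥ h x))
      = star (u b) ⬝ᵥ (P *ᵥ v b) - star (u a) ⬝ᵥ (P *ᵥ v a) := by
  have comp : ∀ {k : ℝ → Fin n → ℂ} {x : ℝ} (i), IntervalIntegrable k volume a x →
      IntervalIntegrable (fun t => k t i) volume a x ∧
      (∫ t in a..x, k t) i = ∫ t in a..x, k t i := fun i hk =>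
    ⟨⟨(ContinuousLinearMap.proj (R := ℝ) (φ := fun _ : Fin n => ℂ) i).integrable_comp hk.1,
      (ContinuousLinearMap.proj (R := ℝ) (φ := fun _ : Fin n => ℂ) i).integrable_comp hk.2⟩,
      ((ContinuousLinearMap.proj (R := ℝ) (φ := fun _ : Fin n => ℂ) i).intervalIntegral_comp_comm
        hk).symm⟩
  have sub : ∀ {k : ℝ → Fin n → ℂ} {x : ℝ}, IntervalIntegrable k volume a b → x ∈ Set.uIcc a b →
      IntervalIntegrable k volume a x := fun hk hx =>
    hk.mono_set (Set.uIcc_subset_uIcc Set.left_mem_uIcc hx)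
  have hui : Set.uIcc a b = Set.Icc a b := Set.uIcc_of_le hab
  have hgs : ∀ i, IntervalIntegrable (fun t => star (g t i)) volume a b := fun i =>
    ⟨(Complex.conjCLE.toContinuousLinearMap).integrable_comp (comp i hg).1.1,
      (Complex.conjCLE.toContinuousLinearMap).integrable_comp (comp i hg).1.2⟩
  have hus : ∀ i, ∀ x ∈ Set.uIcc a b, star (u x i) = star (u a i) + ∫ t in a..x, star (g t i) := by
    intro i x hx
    rw [hu x (hui ▸ hx), Pi.add_apply, (comp i (sub hg hx)).2, star_add]
    congr 1
    exact (Complex.conjCLE.toContinuousLinearMap.intervalIntegral_comp_comm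
      (comp i (sub hg hx)).1).symm
  have hvs : ∀ i, ∀ x ∈ Set.uIcc a b, v x i = v a i + ∫ t in a..x, h t i := by
    intro i x hx
    rw [hv x (hui ▸ hx), Pi.add_apply, (comp i (sub hh hx)).2]
  have hb : b ∈ Set.uIcc a b := Set.right_mem_uIcc
  have e1 : ∀ i j, IntervalIntegrable (fun x => star (g x i) * v x j) volume a b := by
    intro i j
    have := intervalIntegrable_primitive_mul (comp j hh).1 (hgs i) (v a j)
    refine IntervalIntegrable.congr (fun x hx => ?_) this
    simp only [← hvs j x (Set.uIoc_subset_uIcc hx)]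
    ring
  have e2 : ∀ i j, IntervalIntegrable (fun x => star (u x i) * h x j) volume a b := by
    intro i j
    have := intervalIntegrable_primitive_mul (hgs i) (comp j hh).1 (star (u a i))
    refine IntervalIntegrable.congr (fun x hx => ?_) this
    simp only [← hus i x (Set.uIoc_subset_uIcc hx)]
  have e3 : ∀ i j, ∫ x in a..b, (star (g x i) * v x j + star (u x i) * h x j) =
      star (u b i) * v b j - star (u a i) * v a j := by
    intro i j
    have := integral_deriv_mul_complex (hgs i) (comp j hh).1 (star (u a i)) (v a j)
    rw [← hus i b hb, ← hvs j b hb] at this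
    rw [← this]
    apply intervalIntegral.integral_congr
    intro x hx
    simp only [← hus i x hx, ← hvs j x hx]
  have expand : ∀ p q : Fin n → ℂ, star p ⬝ᵥ (P *ᵥ q) = ∑ i, ∑ j, P i j * (star (p i) * q j) := by
    intro p q
    simp only [dotProduct, mulVec, Finset.mul_sum, Pi.star_apply]
    refine Finset.sum_congr rfl fun i _ => Finset.sum_congr rfl fun j _ => by ring
  simp only [expand]
  have isum : ∀ {k : Fin n → ℝ → ℂ}, (∀ i, IntervalIntegrable (k i) volume a b) →
      IntervalIntegrable (fun x => ∑ i, k i x) volume a b := by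
    intro k hk
    have := IntervalIntegrable.sum Finset.univ (fun i (_ : i ∈ Finset.univ) => hk i)
    rwa [Finset.sum_fn] at this
  have i1 : ∀ i j, IntervalIntegrable (fun x => P i j * (star (g x i) * v x j)) volume a b :=
    fun i j => (e1 i j).const_mul _
  have i2 : ∀ i j, IntervalIntegrable (fun x => P i j * (star (u x i) * h x j)) volume a b :=
    fun i j => (e2 i j).const_mul _
  have I1 : ∀ i, IntervalIntegrable (fun x => ∑ j, P i j * (star (g x i) * v x j)) volume a b :=
    fun i => isum fun k => i1 i k
  have I2 : ∀ i, IntervalIntegrable (fun x => ∑ j, P i j * (star (u x i) * h x j)) volume a b :=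
    fun i => isum fun k => i2 i k
  refine ⟨isum fun k => I1 k,
    isum fun k => I2 k, ?_⟩
  simp only [← Finset.sum_add_distrib, ← Finset.sum_sub_distrib, ← mul_add, ← mul_sub]
  rw [intervalIntegral.integral_finsetSum]
  · refine Finset.sum_congr rfl fun i _ => ?_
    rw [intervalIntegral.integral_finsetSum]
    · refine Finset.sum_congr rfl fun j _ => ?_
      rw [intervalIntegral.integral_const_mul, e3]
    · exact fun j _ => ((e1 i j).add (e2 i j)).const_mul _
  · intro i _
    exact isum fun j => ((e1 i j).add (e2 i j)).const_mul (P i j)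

section Pointwise
variable {n : ℕ}

lemma sq_norm_le_dotProduct_self (v : Fin n → ℂ) : ‖v‖ ^ 2 ≤ (star v ⬝ᵥ v).re := by
  have e : (star v ⬝ᵥ v).re = ∑ i, ‖v i‖ ^ 2 := by
    simp [dotProduct, Complex.sq_norm, Complex.normSq_apply]
  rw [e]
  have h0 : 0 ≤ ∑ i, ‖v i‖ ^ 2 := Finset.sum_nonneg fun i _ => by positivity
  rw [← Real.le_sqrt (norm_nonneg _) h0]
  refine (pi_norm_le_iff_of_nonneg (Real.sqrt_nonneg _)).2 fun i => ?_
  exact Real.le_sqrt_of_sq_le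
    (Finset.single_le_sum (f := fun i => ‖v i‖ ^ 2) (fun i _ => by positivity) (Finset.mem_univ i))

lemma dotProduct_self_le_sq_norm (v : Fin n → ℂ) : (star v ⬝ᵥ v).re ≤ n * ‖v‖ ^ 2 := by
  have e : (star v ⬝ᵥ v).re = ∑ i, ‖v i‖ ^ 2 := by
    simp [dotProduct, Complex.sq_norm, Complex.normSq_apply]
  rw [e]
  calc ∑ i, ‖v i‖ ^ 2 ≤ ∑ _i : Fin n, ‖v‖ ^ 2 :=
        Finset.sum_le_sum fun i _ => by gcongr; exact norm_le_pi_norm v i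
    _ = n * ‖v‖ ^ 2 := by simp

lemma norm_dotProduct_le (v w : Fin n → ℂ) : ‖v ⬝ᵥ w‖ ≤ n * (‖v‖ * ‖w‖) := by
  calc ‖v ⬝ᵥ w‖ ≤ ∑ i, ‖v i * w i‖ := norm_sum_le _ _
    _ ≤ ∑ _i : Fin n, ‖v‖ * ‖w‖ := Finset.sum_le_sum fun i _ => by
        rw [norm_mul]; gcongr <;> exact norm_le_pi_norm _ i
    _ = n * (‖v‖ * ‖w‖) := by simp

/-- The quadratic form `v ↦ Re (v* H v)`. -/
noncomputable def quadForm (H : Matrix (Fin n) (Fin n) ℂ) (v : Fin n → ℂ) : ℝ :=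
  (star v ⬝ᵥ (H *ᵥ v)).re

lemma star_dotProduct_mulVec_comm {H : Matrix (Fin n) (Fin n) ℂ} (hH : H.IsHermitian)
    (x y : Fin n → ℂ) : star x ⬝ᵥ (H *ᵥ y) = star (star y ⬝ᵥ (H *ᵥ x)) := by
  rw [star_dotProduct, star_mulVec, hH.eq, dotProduct_mulVec]

lemma star_mulVec_dotProduct (H : Matrix (Fin n) (Fin n) ℂ) (x y : Fin n → ℂ) :
    star (H *ᵥ x) ⬝ᵥ y = star x ⬝ᵥ (H.conjTranspose *ᵥ y) := by
  rw [star_mulVec, dotProduct_mulVec]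

lemma quadForm_smul (H : Matrix (Fin n) (Fin n) ℂ) (c : ℂ) (v : Fin n → ℂ) :
    quadForm H (c • v) = ‖c‖ ^ 2 * quadForm H v := by
  simp only [quadForm, mulVec_smul, star_smul, smul_dotProduct, dotProduct_smul, smul_eq_mul]
  rw [← mul_assoc, mul_comm c]
  have : star c * c = ((‖c‖ ^ 2 : ℝ) : ℂ) := by
    rw [Complex.sq_norm, Complex.normSq_eq_conj_mul_self]; rfl
  rw [this, Complex.re_ofReal_mul]

lemma quadForm_sub_smul {H : Matrix (Fin n) (Fin n) ℂ} (hH : H.IsHermitian) (c : ℂ)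
    (x y : Fin n → ℂ) : quadForm H (x - c • y) =
      quadForm H x - 2 * (star c * (star y ⬝ᵥ (H *ᵥ x))).re + ‖c‖ ^ 2 * quadForm H y := by
  rw [← quadForm_smul]
  simp only [quadForm, mulVec_sub, star_sub, sub_dotProduct, dotProduct_sub, Complex.sub_re]
  have h1 : (star x ⬝ᵥ (H *ᵥ (c • y))).re = (star c * (star y ⬝ᵥ (H *ᵥ x))).re := by
    rw [star_dotProduct_mulVec_comm hH, star_smul, smul_dotProduct, smul_eq_mul]
    simp
  have h2 : (star (c • y) ⬝ᵥ (H *ᵥ x)).re = (star c * (star y ⬝ᵥ (H *ᵥ x))).re := by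
    rw [star_smul, smul_dotProduct, smul_eq_mul]
  rw [h1, h2]; ring

lemma norm_sesq_le {H : Matrix (Fin n) (Fin n) ℂ} (hH : H.IsHermitian)
    (h0 : ∀ v, 0 ≤ quadForm H v) (x y : Fin n → ℂ) :
    ‖star y ⬝ᵥ (H *ᵥ x)‖ ≤ (quadForm H y + quadForm H x) / 2 := by
  set z := star y ⬝ᵥ (H *ᵥ x) with hz
  by_cases hz0 : z = 0
  · rw [hz0, norm_zero]; linarith [h0 x, h0 y]
  have hn : ‖z‖ ≠ 0 := norm_ne_zero_iff.2 hz0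
  have := quadForm_sub_smul hH (z / ‖z‖) x y
  have e1 : star (z / ‖z‖) * z = (‖z‖ : ℂ) := by
    have : star z * z = (‖z‖ : ℂ) ^ 2 := by
      rw [← Complex.ofReal_pow, Complex.sq_norm, Complex.normSq_eq_conj_mul_self]; rfl
    have h3 : star (z / ‖z‖) = star z / ‖z‖ := by simp
    rw [h3, div_mul_eq_mul_div, this]
    have : (‖z‖ : ℂ) ≠ 0 := by exact_mod_cast hn
    field_simp
  rw [← hz, e1, norm_div, Complex.norm_real, norm_norm, div_self hn, Complex.ofReal_re] at this
  have := h0 (x - (z / ‖z‖) • y)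
  linarith

lemma quadForm_add_le {H : Matrix (Fin n) (Fin n) ℂ} (hH : H.IsHermitian)
    (h0 : ∀ v, 0 ≤ quadForm H v) (x y : Fin n → ℂ) :
    quadForm H (x + y) ≤ 2 * (quadForm H x + quadForm H y) := by
  have h1 := quadForm_sub_smul hH 1 x y
  have h2 := quadForm_sub_smul hH (-1) x y
  have h3 := h0 (x - (1 : ℂ) • y)
  have e : x - (-1 : ℂ) • y = x + y := by ext; simp
  rw [e] at h2
  simp at h1 h2
  rw [one_smul] at h3
  linarith

lemma mulVec_self_le {H : Matrix (Fin n) (Fin n) ℂ} (hH : H.IsHermitian)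
    (h0 : ∀ v, 0 ≤ quadForm H v) {M : ℝ} (hM : 0 < M)
    (h : ∀ v, quadForm H v ≤ M * (star v ⬝ᵥ v).re) (x : Fin n → ℂ) :
    (star (H *ᵥ x) ⬝ᵥ (H *ᵥ x)).re ≤ M * quadForm H x := by
  have h1 := quadForm_sub_smul hH ((M⁻¹ : ℝ) : ℂ) x (H *ᵥ x)
  have h2 := h0 (x - ((M⁻¹ : ℝ) : ℂ) • (H *ᵥ x))
  have h3 := h (H *ᵥ x)
  have e : star ((M⁻¹ : ℝ) : ℂ) = ((M⁻¹ : ℝ) : ℂ) := Complex.conj_ofReal _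
  rw [h1, e, Complex.re_ofReal_mul, Complex.norm_real, Real.norm_eq_abs, sq_abs] at h2
  set s := (star (H *ᵥ x) ⬝ᵥ (H *ᵥ x)).re
  have h4 : M⁻¹ ^ 2 * quadForm H (H *ᵥ x) ≤ M⁻¹ * s := by
    calc M⁻¹ ^ 2 * quadForm H (H *ᵥ x) ≤ M⁻¹ ^ 2 * (M * s) := by gcongr
      _ = M⁻¹ * s := by field_simp
  have h5 : M⁻¹ * s ≤ quadForm H x := by linarith
  rwa [inv_mul_le_iff₀ hM] at h5

lemma quadForm_le_mulVec_self {H : Matrix (Fin n) (Fin n) ℂ} {m : ℝ} (hm : 0 < m)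
    (x : Fin n → ℂ) (h : m * (star x ⬝ᵥ x).re ≤ quadForm H x) :
    m * quadForm H x ≤ (star (H *ᵥ x) ⬝ᵥ (H *ᵥ x)).re := by
  have h1 := quadForm_sub_smul (H := (1 : Matrix (Fin n) (Fin n) ℂ)) Matrix.isHermitian_one
    (m : ℂ) (H *ᵥ x) x
  have e : star (m : ℂ) = (m : ℂ) := Complex.conj_ofReal _
  simp only [quadForm, one_mulVec, e, Complex.re_ofReal_mul, Complex.norm_real, Real.norm_eq_abs,
    sq_abs] at h1
  have h2 : 0 ≤ (star (H *ᵥ x - (m : ℂ) • x) ⬝ᵥ (H *ᵥ x - (m : ℂ) • x)).re :=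
    le_trans (by positivity) (sq_norm_le_dotProduct_self _)
  rw [h1] at h2
  have h3 := mul_le_mul_of_nonneg_left h hm.le
  unfold quadForm at *
  nlinarith

end Pointwise

section Weight
variable {n : ℕ} {𝓗 : ℝ → Matrix (Fin n) (Fin n) ℂ}

/-- The standing assumptions on the Hamiltonian density `𝓗` on the semi-axis. -/
structure IsWeight (n : ℕ) (𝓗 : ℝ → Matrix (Fin n) (Fin n) ℂ) : Prop where
  meas : ∀ i j, AEMeasurable (fun ξ => 𝓗 ξ i j) (volume.restrict (Set.Ioi 0))
  herm : ∀ᵐ ξ ∂(volume.restrict (Set.Ioi 0)), (𝓗 ξ).IsHermitian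
  loc : ∀ N : ℝ, ∃ m : ℝ, 0 < m ∧ ∀ᵐ ξ ∂(volume.restrict (Set.Ioi (0 : ℝ))), ξ ≤ N →
    ∀ ζ : Fin n → ℂ, m * (star ζ ⬝ᵥ ζ).re ≤ quadForm (𝓗 ξ) ζ
  bdd : ∃ M : ℝ, 0 < M ∧ ∀ᵐ ξ ∂(volume.restrict (Set.Ioi (0 : ℝ))), ∀ ζ : Fin n → ℂ,
    quadForm (𝓗 ξ) ζ ≤ M * (star ζ ⬝ᵥ ζ).re

lemma IsWeight.aestronglyMeasurable (h : IsWeight n 𝓗) :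
    AEStronglyMeasurable 𝓗 (volume.restrict (Set.Ioi 0)) := by
  have : AEMeasurable (fun ξ i j => 𝓗 ξ i j) (volume.restrict (Set.Ioi (0 : ℝ))) :=
    aemeasurable_pi_lambda _ fun i => aemeasurable_pi_lambda _ fun j => h.meas i j
  exact this.aestronglyMeasurable

lemma IsWeight.nonneg (h : IsWeight n 𝓗) :
    ∀ᵐ ξ ∂(volume.restrict (Set.Ioi (0 : ℝ))), (∀ v, 0 ≤ quadForm (𝓗 ξ) v) ∧ IsUnit (𝓗 ξ) := by
  choose m hm hmq using fun N : ℕ => h.loc N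
  filter_upwards [ae_all_iff.2 hmq] with ξ hξ
  obtain ⟨N, hN⟩ := exists_nat_ge ξ
  have key := hξ N hN
  refine ⟨fun v => le_trans (mul_nonneg (hm N).le ?_) (key v), ?_⟩
  · exact le_trans (by positivity) (sq_norm_le_dotProduct_self v)
  · rw [← Matrix.mulVec_injective_iff_isUnit]
    intro x y hxy
    have h1 := key (x - y)
    rw [quadForm, mulVec_sub, hxy, sub_self, dotProduct_zero, Complex.zero_re] at h1
    have h2 := sq_norm_le_dotProduct_self (x - y)
    have h3 : ‖x - y‖ ^ 2 ≤ 0 := by nlinarith [hm N]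
    have h4 : ‖x - y‖ = 0 := by nlinarith [norm_nonneg (x - y)]
    exact sub_eq_zero.1 (norm_eq_zero.1 h4)

lemma IsWeight.aestronglyMeasurable_mulVec (h : IsWeight n 𝓗) {x : ℝ → Fin n → ℂ}
    (hx : AEStronglyMeasurable x (volume.restrict (Set.Ioi 0))) :
    AEStronglyMeasurable (fun ξ => 𝓗 ξ *ᵥ x ξ) (volume.restrict (Set.Ioi 0)) := by
  have hc : Continuous fun p : Matrix (Fin n) (Fin n) ℂ × (Fin n → ℂ) => p.1 *ᵥ p.2 := by fun_prop
  exact hc.comp_aestronglyMeasurable (h.aestronglyMeasurable.prodMk hx)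

lemma IsWeight.aestronglyMeasurable_sesq (h : IsWeight n 𝓗) {x y : ℝ → Fin n → ℂ}
    (hx : AEStronglyMeasurable x (volume.restrict (Set.Ioi 0)))
    (hy : AEStronglyMeasurable y (volume.restrict (Set.Ioi 0))) :
    AEStronglyMeasurable (fun ξ => star (y ξ) ⬝ᵥ (𝓗 ξ *ᵥ x ξ)) (volume.restrict (Set.Ioi 0)) := by
  have hc : Continuous fun p : (Fin n → ℂ) × (Fin n → ℂ) => star p.1 ⬝ᵥ p.2 := by fun_prop
  have := hc.comp_aestronglyMeasurable (hy.prodMk (h.aestronglyMeasurable_mulVec hx))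
  exact this

lemma IsWeight.aestronglyMeasurable_inv_mulVec (h : IsWeight n 𝓗) {x : ℝ → Fin n → ℂ}
    (hx : AEStronglyMeasurable x (volume.restrict (Set.Ioi 0))) :
    AEStronglyMeasurable (fun ξ => (𝓗 ξ)⁻¹ *ᵥ x ξ) (volume.restrict (Set.Ioi 0)) := by
  have hc : Continuous fun p : (ℂ × Matrix (Fin n) (Fin n) ℂ) × (Fin n → ℂ) =>
      p.1.1 • (p.1.2.adjugate *ᵥ p.2) := by fun_prop
  have hd : Continuous fun A : Matrix (Fin n) (Fin n) ℂ => A.det := by fun_prop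
  have h1 : AEStronglyMeasurable (fun ξ => ((𝓗 ξ).det)⁻¹) (volume.restrict (Set.Ioi 0)) :=
    (hd.comp_aestronglyMeasurable h.aestronglyMeasurable).aemeasurable.inv.aestronglyMeasurable
  have := hc.comp_aestronglyMeasurable ((h1.prodMk h.aestronglyMeasurable).prodMk hx)
  refine this.congr (Filter.Eventually.of_forall fun ξ => ?_)
  simp [Matrix.inv_def, smul_mulVec]

lemma IsWeight.aestronglyMeasurable_quadForm (h : IsWeight n 𝓗) {x : ℝ → Fin n → ℂ}
    (hx : AEStronglyMeasurable x (volume.restrict (Set.Ioi 0))) :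
    AEStronglyMeasurable (fun ξ => quadForm (𝓗 ξ) (x ξ)) (volume.restrict (Set.Ioi 0)) :=
  Complex.continuous_re.comp_aestronglyMeasurable (h.aestronglyMeasurable_sesq hx hx)

/-- Domination criterion for membership in `L²_𝓗`. -/
lemma IsWeight.memL2w_of_le (h : IsWeight n 𝓗) {x : ℝ → Fin n → ℂ} {F : ℝ → ℝ}
    (hx : AEStronglyMeasurable x (volume.restrict (Set.Ioi 0))) (hF : IntegrableOn F (Set.Ioi 0))
    (hle : ∀ᵐ ξ ∂(volume.restrict (Set.Ioi (0 : ℝ))), quadForm (𝓗 ξ) (x ξ) ≤ F ξ) :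
    MemL2w n 𝓗 (Set.Ioi 0) x := by
  refine ⟨hx, Integrable.mono' hF (h.aestronglyMeasurable_quadForm hx) ?_⟩
  filter_upwards [hle, h.nonneg] with ξ h1 h2
  rw [Real.norm_eq_abs]
  exact (abs_of_nonneg (h2.1 (x ξ))).trans_le h1

lemma memL2w_congr {x y : ℝ → Fin n → ℂ} (hx : MemL2w n 𝓗 (Set.Ioi 0) x)
    (hxy : y =ᵐ[volume.restrict (Set.Ioi 0)] x) : MemL2w n 𝓗 (Set.Ioi 0) y := by
  refine ⟨hx.1.congr hxy.symm, hx.2.congr ?_⟩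
  filter_upwards [hxy] with ξ hξ
  rw [hξ]

lemma IsWeight.memL2w_add (h : IsWeight n 𝓗) {x y : ℝ → Fin n → ℂ}
    (hx : MemL2w n 𝓗 (Set.Ioi 0) x) (hy : MemL2w n 𝓗 (Set.Ioi 0) y) :
    MemL2w n 𝓗 (Set.Ioi 0) (fun ξ => x ξ + y ξ) := by
  refine h.memL2w_of_le (hx.1.add hy.1) ((hx.2.add hy.2).const_mul 2) ?_
  filter_upwards [h.nonneg, h.herm] with ξ h1 h2
  exact quadForm_add_le h2 h1.1 _ _

lemma memL2w_smul (c : ℂ) {x : ℝ → Fin n → ℂ}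
    (hx : MemL2w n 𝓗 (Set.Ioi 0) x) : MemL2w n 𝓗 (Set.Ioi 0) (fun ξ => c • x ξ) := by
  refine ⟨hx.1.const_smul c, (hx.2.const_mul (‖c‖ ^ 2)).congr ?_⟩
  exact Filter.Eventually.of_forall fun ξ => (quadForm_smul _ c _).symm

lemma memL2w_neg {x : ℝ → Fin n → ℂ}
    (hx : MemL2w n 𝓗 (Set.Ioi 0) x) : MemL2w n 𝓗 (Set.Ioi 0) (fun ξ => -x ξ) := by
  simpa using memL2w_smul (-1) hx

/-- Square integrable functions belong to `L²_𝓗`, since `𝓗` is bounded. -/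
lemma IsWeight.memL2w_of_memLp (h : IsWeight n 𝓗) {x : ℝ → Fin n → ℂ}
    (hx : MemLp x 2 (volume.restrict (Set.Ioi 0))) : MemL2w n 𝓗 (Set.Ioi 0) x := by
  obtain ⟨M, hM, hb⟩ := h.bdd
  refine h.memL2w_of_le hx.1
    (((memLp_two_iff_integrable_sq_norm hx.1).1 hx).const_mul (M * n)) ?_
  filter_upwards [hb] with ξ h1
  refine (h1 _).trans ?_
  rw [mul_assoc]
  gcongr
  exact dotProduct_self_le_sq_norm _

lemma IsWeight.memLp_mulVec (h : IsWeight n 𝓗) {x : ℝ → Fin n → ℂ}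
    (hx : MemL2w n 𝓗 (Set.Ioi 0) x) :
    MemLp (fun ξ => 𝓗 ξ *ᵥ x ξ) 2 (volume.restrict (Set.Ioi 0)) := by
  obtain ⟨M, hM, hb⟩ := h.bdd
  have hm := h.aestronglyMeasurable_mulVec hx.1
  rw [memLp_two_iff_integrable_sq_norm hm]
  refine Integrable.mono' (hx.2.const_mul M) (hm.norm.pow 2) ?_
  filter_upwards [hb, h.nonneg, h.herm] with ξ h1 h2 h3
  rw [Real.norm_eq_abs, abs_of_nonneg (by positivity)]
  exact (sq_norm_le_dotProduct_self _).trans (mulVec_self_le h3 h2.1 hM h1 _)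

lemma IsWeight.memLp_Ioc (h : IsWeight n 𝓗) {x : ℝ → Fin n → ℂ}
    (hx : MemL2w n 𝓗 (Set.Ioi 0) x) (N : ℝ) : MemLp x 2 (volume.restrict (Set.Ioc 0 N)) := by
  obtain ⟨m, hm, hb⟩ := h.loc N
  have hle : volume.restrict (Set.Ioc 0 N) ≤ volume.restrict (Set.Ioi (0 : ℝ)) :=
    Measure.restrict_mono Set.Ioc_subset_Ioi_self le_rfl
  have hxm := hx.1.mono_measure hle
  rw [memLp_two_iff_integrable_sq_norm hxm]
  refine Integrable.mono' ((hx.2.mono_measure hle).const_mul m⁻¹) (hxm.norm.pow 2) ?_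
  filter_upwards [ae_mono hle hb, ae_restrict_mem measurableSet_Ioc] with ξ h1 h2
  rw [Real.norm_eq_abs, abs_of_nonneg (by positivity), ← div_eq_inv_mul, le_div_iff₀' hm]
  exact le_trans (by gcongr; exact sq_norm_le_dotProduct_self _) (h1 h2.2 _)

lemma IsWeight.intervalIntegrable (h : IsWeight n 𝓗) {x : ℝ → Fin n → ℂ}
    (hx : MemL2w n 𝓗 (Set.Ioi 0) x) {N : ℝ} (hN : 0 ≤ N) :
    IntervalIntegrable x volume 0 N := by
  rw [intervalIntegrable_iff_integrableOn_Ioc_of_le hN]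
  exact (h.memLp_Ioc hx N).integrable (by norm_num)

lemma IsWeight.integrable_sesq (h : IsWeight n 𝓗) {x y : ℝ → Fin n → ℂ}
    (hx : MemL2w n 𝓗 (Set.Ioi 0) x) (hy : MemL2w n 𝓗 (Set.Ioi 0) y) :
    IntegrableOn (fun ξ => star (y ξ) ⬝ᵥ (𝓗 ξ *ᵥ x ξ)) (Set.Ioi 0) := by
  refine Integrable.mono' ((hy.2.add hx.2).div_const 2) (h.aestronglyMeasurable_sesq hx.1 hy.1) ?_
  filter_upwards [h.nonneg, h.herm] with ξ h1 h2
  exact norm_sesq_le h2 h1.1 _ _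

lemma IsWeight.ae_mulVec_inv (h : IsWeight n 𝓗) (u : ℝ → Fin n → ℂ) :
    ∀ᵐ ξ ∂(volume.restrict (Set.Ioi (0 : ℝ))), u ξ = 𝓗 ξ *ᵥ ((𝓗 ξ)⁻¹ *ᵥ u ξ) := by
  filter_upwards [h.nonneg] with ξ h1
  rw [mulVec_mulVec, Matrix.mul_nonsing_inv _ ((Matrix.isUnit_iff_isUnit_det _).1 h1.2),
    one_mulVec]

lemma memLp_mulVec_const {μ : Measure ℝ} (P : Matrix (Fin n) (Fin n) ℂ) {x : ℝ → Fin n → ℂ}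
    (hx : MemLp x 2 μ) : MemLp (fun ξ => P *ᵥ x ξ) 2 μ :=
  (LinearMap.toContinuousLinearMap (Matrix.mulVecLin P)).comp_memLp' hx

lemma intervalIntegrable_mulVec_const (P : Matrix (Fin n) (Fin n) ℂ) {x : ℝ → Fin n → ℂ} {a b : ℝ}
    (hx : IntervalIntegrable x volume a b) :
    IntervalIntegrable (fun ξ => P *ᵥ x ξ) volume a b ∧
      ∫ t in a..b, P *ᵥ x t = P *ᵥ ∫ t in a..b, x t :=
  ⟨⟨(LinearMap.toContinuousLinearMap (Matrix.mulVecLin P)).integrable_comp hx.1,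
    (LinearMap.toContinuousLinearMap (Matrix.mulVecLin P)).integrable_comp hx.2⟩,
    (LinearMap.toContinuousLinearMap (Matrix.mulVecLin P)).intervalIntegral_comp_comm hx⟩

end Weight

section Semi
variable {n : ℕ} {𝓗 : ℝ → Matrix (Fin n) (Fin n) ℂ}

/-- `u` is the indefinite integral on `[0, ∞)` of the locally integrable function `g`. -/
structure IsPrimitive (u g : ℝ → Fin n → ℂ) : Prop where
  int : ∀ N : ℝ, 0 ≤ N → IntervalIntegrable g volume 0 N
  eq : ∀ ξ ∈ Set.Ici (0 : ℝ), u ξ = u 0 + ∫ τ in (0 : ℝ)..ξ, g τ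

lemma IsPrimitive.continuousOn {u g : ℝ → Fin n → ℂ} (h : IsPrimitive u g) :
    ContinuousOn u (Set.Ici 0) := by
  have h1 : ContinuousOn (fun ξ => u 0 + ∫ τ in (0 : ℝ)..ξ, g τ) (Set.Ici 0) := by
    refine continuousOn_const.add ?_
    intro x hx
    have hx0 : (0 : ℝ) ≤ x := hx
    have := intervalIntegral.continuousOn_primitive_interval' (h.int (x + 1) (by linarith))
      (Set.left_mem_uIcc)
    rw [Set.uIcc_of_le (by linarith)] at this
    refine (this x ⟨hx0, by linarith⟩).mono_of_mem_nhdsWithin ?_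
    have : Set.Ici 0 ∩ Set.Iio (x + 1) ∈ nhdsWithin x (Set.Ici 0) :=
      Filter.inter_mem self_mem_nhdsWithin (mem_nhdsWithin_of_mem_nhds (Iio_mem_nhds (by linarith)))
    exact Filter.mem_of_superset this fun y hy => ⟨hy.1, le_of_lt hy.2⟩
  exact h1.congr h.eq

lemma IsPrimitive.aestronglyMeasurable {u g : ℝ → Fin n → ℂ} (h : IsPrimitive u g) :
    AEStronglyMeasurable u (volume.restrict (Set.Ioi 0)) :=
  (h.continuousOn.mono Set.Ioi_subset_Ici_self).aestronglyMeasurable measurableSet_Ioi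

lemma eqOn_Ici_of_ae_eq {u v : ℝ → Fin n → ℂ} (hu : ContinuousOn u (Set.Ici 0))
    (hv : ContinuousOn v (Set.Ici 0)) (huv : u =ᵐ[volume.restrict (Set.Ioi 0)] v) :
    Set.EqOn u v (Set.Ici 0) := by
  refine MeasureTheory.Measure.eqOn_of_ae_eq (μ := volume) ?_ hu hv ?_
  · rw [← restrict_Ioi_eq_restrict_Ici]; exact huv
  · rw [interior_Ici, closure_Ioi]

lemma IsPrimitive.unique {u g v k : ℝ → Fin n → ℂ} (h : IsPrimitive u g)
    (h' : IsPrimitive v k) (huv : u =ᵐ[volume.restrict (Set.Ioi 0)] v) :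
    u 0 = v 0 ∧ g =ᵐ[volume.restrict (Set.Ioi 0)] k := by
  have he := eqOn_Ici_of_ae_eq h.continuousOn h'.continuousOn huv
  have h0 : u 0 = v 0 := he (Set.mem_Ici.2 le_rfl)
  refine ⟨h0, ?_⟩
  rw [Filter.EventuallyEq, ae_restrict_iff' measurableSet_Ioi]
  have key := fun N : ℕ => (h.int N N.cast_nonneg).ae_hasDerivAt_integral
  have key' := fun N : ℕ => (h'.int N N.cast_nonneg).ae_hasDerivAt_integral
  filter_upwards [ae_all_iff.2 key, ae_all_iff.2 key'] with x h1 h2 hx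
  have hx0 : (0 : ℝ) < x := hx
  obtain ⟨N, hN⟩ := exists_nat_ge x
  have hxN : x ∈ Set.uIcc (0 : ℝ) N := by
    rw [Set.uIcc_of_le N.cast_nonneg]; exact ⟨hx0.le, hN⟩
  have d1 := h1 N hxN 0 Set.left_mem_uIcc
  have d2 := h2 N hxN 0 Set.left_mem_uIcc
  refine d1.unique (d2.congr_of_eventuallyEq ?_)
  filter_upwards [Ioi_mem_nhds hx0] with y hy
  have hy0 : y ∈ Set.Ici (0 : ℝ) := Set.mem_Ici.2 (le_of_lt (Set.mem_Ioi.1 hy))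
  have e := he hy0
  rw [h.eq y hy0, h'.eq y hy0, h0] at e
  exact add_left_cancel e

lemma RepSemi.isPrimitive (h : IsWeight n 𝓗) {x u g : ℝ → Fin n → ℂ} (hr : RepSemi n 𝓗 x u g) :
    IsPrimitive u g :=
  ⟨fun _ hN => h.intervalIntegrable hr.2.2 hN, hr.2.1⟩

lemma eq_zero_of_tendsto_of_integrableOn {φ : ℝ → ℝ} {L : ℝ} (hφ : IntegrableOn φ (Set.Ioi 0))
    (hL : Filter.Tendsto φ Filter.atTop (nhds L)) : L = 0 := by
  by_contra hne
  have hpos : 0 < |L| := abs_pos.2 hne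
  have h1 : ∀ᶠ ξ in Filter.atTop, |L| / 2 < |φ ξ| :=
    hL.abs.eventually (lt_mem_nhds (by linarith))
  obtain ⟨N, hN⟩ := Filter.eventually_atTop.1 h1
  have h2 : IntegrableOn (fun _ : ℝ => |L| / 2) (Set.Ioi (max N 0)) := by
    refine Integrable.mono' (hφ.norm.mono_measure
      (Measure.restrict_mono (Set.Ioi_subset_Ioi (le_max_right N 0)) le_rfl))
      aestronglyMeasurable_const ?_
    filter_upwards [ae_restrict_mem measurableSet_Ioi] with ξ hξ
    rw [Real.norm_eq_abs, abs_of_pos (by linarith), Real.norm_eq_abs]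
    exact (hN ξ (le_trans (le_max_left N 0) (le_of_lt hξ))).le
  rw [integrableOn_const_iff] at h2
  simp [hne] at h2

/-- The pair `(x, y)` satisfies `y = -P₁ (𝓗x)' - P₀ 𝓗x`, the derivative being only required to
be locally integrable; `u` represents `𝓗x` and `g` its derivative. -/
structure AdjPair (n : ℕ) (𝓗 : ℝ → Matrix (Fin n) (Fin n) ℂ) (P1 P0 : Matrix (Fin n) (Fin n) ℂ)
    (x y u g : ℝ → Fin n → ℂ) : Prop where
  left : MemL2w n 𝓗 (Set.Ioi 0) x
  right : MemL2w n 𝓗 (Set.Ioi 0) y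
  rep : ∀ᵐ ξ ∂(volume.restrict (Set.Ioi 0)), u ξ = 𝓗 ξ *ᵥ x ξ
  prim : IsPrimitive u g
  eq : ∀ᵐ ξ ∂(volume.restrict (Set.Ioi 0)), y ξ = -(P1 *ᵥ g ξ) - P0 *ᵥ u ξ

/-- Green's identity: the boundary term at infinity vanishes because `𝓗` is bounded. -/
lemma AdjPair.green (h : IsWeight n 𝓗) {P1 P0 : Matrix (Fin n) (Fin n) ℂ}
    (hP1 : P1.IsHermitian) (hP0 : P0.conjTranspose = -P0) {x y u g : ℝ → Fin n → ℂ}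
    (hp : AdjPair n 𝓗 P1 P0 x y u g) :
    (wip n 𝓗 (Set.Ioi 0) y x).re = quadForm P1 (u 0) / 2 := by
  have hF := h.integrable_sesq hp.left hp.right
  have hle : ∀ N : ℝ, volume.restrict (Set.Ioc 0 N) ≤ volume.restrict (Set.Ioi (0 : ℝ)) :=
    fun N => Measure.restrict_mono Set.Ioc_subset_Ioi_self le_rfl
  have step : ∀ N : ℝ, 0 ≤ N → (∫ ξ in (0 : ℝ)..N, star (y ξ) ⬝ᵥ (𝓗 ξ *ᵥ x ξ)).re =
      -(quadForm P1 (u N) - quadForm P1 (u 0)) / 2 := by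
    intro N hN
    obtain ⟨i1, i2, i3⟩ := integral_deriv_dotProduct P1 hN (hp.prim.int N hN) (hp.prim.int N hN)
      (fun ξ hξ => hp.prim.eq ξ hξ.1) (fun ξ hξ => hp.prim.eq ξ hξ.1)
    have hFN : IntervalIntegrable (fun ξ => star (y ξ) ⬝ᵥ (𝓗 ξ *ᵥ x ξ)) volume 0 N := by
      rw [intervalIntegrable_iff_integrableOn_Ioc_of_le hN]
      exact hF.mono_set Set.Ioc_subset_Ioi_self
    have c1 : (∫ ξ in (0 : ℝ)..N, star (y ξ) ⬝ᵥ (𝓗 ξ *ᵥ x ξ)).re =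
        ∫ ξ in (0 : ℝ)..N, (star (y ξ) ⬝ᵥ (𝓗 ξ *ᵥ x ξ)).re :=
      (Complex.reCLM.intervalIntegral_comp_comm hFN).symm
    have c2 : (∫ ξ in (0 : ℝ)..N, (star (g ξ) ⬝ᵥ (P1 *ᵥ u ξ) + star (u ξ) ⬝ᵥ (P1 *ᵥ g ξ))).re =
        ∫ ξ in (0 : ℝ)..N, (star (g ξ) ⬝ᵥ (P1 *ᵥ u ξ) + star (u ξ) ⬝ᵥ (P1 *ᵥ g ξ)).re :=
      (Complex.reCLM.intervalIntegral_comp_comm (i1.add i2)).symm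
    rw [i3, Complex.sub_re] at c2
    have c3 : ∫ ξ in (0 : ℝ)..N, (star (y ξ) ⬝ᵥ (𝓗 ξ *ᵥ x ξ)).re =
        ∫ ξ in (0 : ℝ)..N, (-1 / 2 : ℝ) *
          (star (g ξ) ⬝ᵥ (P1 *ᵥ u ξ) + star (u ξ) ⬝ᵥ (P1 *ᵥ g ξ)).re := by
      refine intervalIntegral.integral_congr_ae ?_
      rw [Set.uIoc_of_le hN, ← ae_restrict_iff' measurableSet_Ioc]
      filter_upwards [ae_mono (hle N) hp.rep, ae_mono (hle N) hp.eq] with ξ e1 e2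
      rw [← e1, e2, star_sub, star_neg, sub_dotProduct, neg_dotProduct, star_mulVec_dotProduct,
        star_mulVec_dotProduct, hP1.eq, hP0, neg_mulVec, dotProduct_neg, Complex.sub_re,
        Complex.neg_re, Complex.neg_re, Complex.add_re,
        star_dotProduct_mulVec_comm hP1 (u ξ) (g ξ)]
      have e3 : (star (u ξ) ⬝ᵥ (P0 *ᵥ u ξ)).re = 0 := by
        have := star_mulVec_dotProduct P0 (u ξ) (u ξ)
        rw [hP0, neg_mulVec, dotProduct_neg] at this
        have h4 : star (P0 *ᵥ u ξ) ⬝ᵥ u ξ = star (star (u ξ) ⬝ᵥ (P0 *ᵥ u ξ)) := by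
          rw [star_dotProduct]
        rw [h4] at this
        have h5 := congrArg Complex.re this
        simp at h5
        linarith
      rw [e3]
      simp
      ring
    rw [c1, c3, intervalIntegral.integral_const_mul, ← c2]
    unfold quadForm
    ring
  have ht : Filter.Tendsto (fun N => (∫ ξ in (0 : ℝ)..N, star (y ξ) ⬝ᵥ (𝓗 ξ *ᵥ x ξ)).re)
      Filter.atTop (nhds (wip n 𝓗 (Set.Ioi 0) y x).re) :=
    (Complex.continuous_re.tendsto _).comp
      (intervalIntegral_tendsto_integral_Ioi 0 hF Filter.tendsto_id)
  have hφ : Filter.Tendsto (fun N => quadForm P1 (u N)) Filter.atTop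
      (nhds (quadForm P1 (u 0) - 2 * (wip n 𝓗 (Set.Ioi 0) y x).re)) := by
    refine (ht.const_mul 2).const_sub (quadForm P1 (u 0)) |>.congr' ?_
    filter_upwards [Filter.eventually_ge_atTop 0] with N hN
    rw [step N hN]
    ring
  have hint : IntegrableOn (fun ξ => quadForm P1 (u ξ)) (Set.Ioi 0) := by
    have a1 := h.memLp_mulVec hp.left
    have a2 := memLp_mulVec_const P1 a1
    have b1 := (memLp_two_iff_integrable_sq_norm a1.1).1 a1
    have b2 := (memLp_two_iff_integrable_sq_norm a2.1).1 a2
    have hc : Continuous fun v : Fin n → ℂ => quadForm P1 v := by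
      unfold quadForm
      fun_prop
    refine Integrable.mono' ((b1.add b2).const_mul (n : ℝ))
      (hc.comp_aestronglyMeasurable hp.prim.aestronglyMeasurable) ?_
    filter_upwards [hp.rep] with ξ e
    rw [e]
    set a := 𝓗 ξ *ᵥ x ξ
    calc ‖quadForm P1 a‖ ≤ ‖star a ⬝ᵥ (P1 *ᵥ a)‖ := Complex.abs_re_le_norm _
      _ ≤ n * (‖star a‖ * ‖P1 *ᵥ a‖) := norm_dotProduct_le _ _
      _ ≤ n * (‖a‖ ^ 2 + ‖P1 *ᵥ a‖ ^ 2) := by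
        rw [norm_star]
        gcongr
        nlinarith [sq_nonneg (‖a‖ - ‖P1 *ᵥ a‖), sq_nonneg (‖a‖), sq_nonneg ‖P1 *ᵥ a‖]
  have := eq_zero_of_tendsto_of_integrableOn hint hφ
  linarith

lemma GraphAstarSemi.exists_adjPair (h : IsWeight n 𝓗) {P1 P0 : Matrix (Fin n) (Fin n) ℂ}
    {x y : ℝ → Fin n → ℂ} (hG : GraphAstarSemi n 𝓗 P1 P0 x y) :
    ∃ u g, AdjPair n 𝓗 P1 P0 x y u g ∧ MemL2w n 𝓗 (Set.Ioi 0) g := by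
  obtain ⟨hx, hy, u, g, hr, he⟩ := hG
  exact ⟨u, g, ⟨hx, hy, hr.1, hr.isPrimitive h, he⟩, hr.2.2⟩

lemma AdjPair.unique {P1 P0 : Matrix (Fin n) (Fin n) ℂ} {x y u g x' y' u' g' : ℝ → Fin n → ℂ}
    (hp : AdjPair n 𝓗 P1 P0 x y u g) (hp' : AdjPair n 𝓗 P1 P0 x' y' u' g')
    (hx : x =ᵐ[volume.restrict (Set.Ioi 0)] x') :
    u 0 = u' 0 ∧ g =ᵐ[volume.restrict (Set.Ioi 0)] g' ∧ y =ᵐ[volume.restrict (Set.Ioi 0)] y' := by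
  have huv : u =ᵐ[volume.restrict (Set.Ioi 0)] u' := by
    filter_upwards [hp.rep, hp'.rep, hx] with ξ h1 h2 h3
    rw [h1, h2, h3]
  obtain ⟨h0, hg⟩ := hp.prim.unique hp'.prim huv
  refine ⟨h0, hg, ?_⟩
  filter_upwards [hg, huv, hp.eq, hp'.eq] with ξ h1 h2 h3 h4
  rw [h3, h4, h1, h2]

lemma IsPrimitive.add {u g v k : ℝ → Fin n → ℂ} (h : IsPrimitive u g) (h' : IsPrimitive v k) :
    IsPrimitive (fun ξ => u ξ + v ξ) (fun ξ => g ξ + k ξ) := by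
  refine ⟨fun N hN => (h.int N hN).add (h'.int N hN), fun ξ hξ => ?_⟩
  rw [intervalIntegral.integral_add (h.int ξ hξ) (h'.int ξ hξ), h.eq ξ hξ, h'.eq ξ hξ]
  abel

lemma IsPrimitive.smul {u g : ℝ → Fin n → ℂ} (c : ℂ) (h : IsPrimitive u g) :
    IsPrimitive (fun ξ => c • u ξ) (fun ξ => c • g ξ) := by
  refine ⟨fun N hN => (h.int N hN).smul c, fun ξ hξ => ?_⟩
  rw [intervalIntegral.integral_smul, h.eq ξ hξ, smul_add]

lemma AdjPair.add (h : IsWeight n 𝓗) {P1 P0 : Matrix (Fin n) (Fin n) ℂ}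
    {x y u g x' y' u' g' : ℝ → Fin n → ℂ}
    (hp : AdjPair n 𝓗 P1 P0 x y u g) (hp' : AdjPair n 𝓗 P1 P0 x' y' u' g') :
    AdjPair n 𝓗 P1 P0 (fun ξ => x ξ + x' ξ) (fun ξ => y ξ + y' ξ) (fun ξ => u ξ + u' ξ)
      (fun ξ => g ξ + g' ξ) := by
  refine ⟨h.memL2w_add hp.left hp'.left, h.memL2w_add hp.right hp'.right, ?_,
    hp.prim.add hp'.prim, ?_⟩
  · filter_upwards [hp.rep, hp'.rep] with ξ h1 h2
    rw [h1, h2, mulVec_add]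
  · filter_upwards [hp.eq, hp'.eq] with ξ h1 h2
    rw [h1, h2, mulVec_add, mulVec_add]
    abel

lemma AdjPair.smul {P1 P0 : Matrix (Fin n) (Fin n) ℂ} (c : ℂ)
    {x y u g : ℝ → Fin n → ℂ} (hp : AdjPair n 𝓗 P1 P0 x y u g) :
    AdjPair n 𝓗 P1 P0 (fun ξ => c • x ξ) (fun ξ => c • y ξ) (fun ξ => c • u ξ)
      (fun ξ => c • g ξ) := by
  refine ⟨memL2w_smul c hp.left, memL2w_smul c hp.right, ?_, hp.prim.smul c, ?_⟩
  · filter_upwards [hp.rep] with ξ h1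
    rw [h1, mulVec_smul]
  · filter_upwards [hp.eq] with ξ h1
    rw [h1, mulVec_smul, mulVec_smul, smul_sub, smul_neg]

lemma AdjPair.congr {P1 P0 : Matrix (Fin n) (Fin n) ℂ} {x y u g x' y' : ℝ → Fin n → ℂ}
    (hp : AdjPair n 𝓗 P1 P0 x y u g) (hx : x' =ᵐ[volume.restrict (Set.Ioi 0)] x)
    (hy : y' =ᵐ[volume.restrict (Set.Ioi 0)] y) : AdjPair n 𝓗 P1 P0 x' y' u g := by
  refine ⟨memL2w_congr hp.left hx, memL2w_congr hp.right hy, ?_, hp.prim, ?_⟩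
  · filter_upwards [hp.rep, hx] with ξ h1 h2
    rw [h1, h2]
  · filter_upwards [hp.eq, hy] with ξ h1 h2
    rw [← h1, h2]

lemma IsWeight.quadForm_inv_mulVec_le (h : IsWeight n 𝓗) {m N : ℝ} (hm : 0 < m)
    (hb : ∀ᵐ ξ ∂(volume.restrict (Set.Ioi (0 : ℝ))), ξ ≤ N →
      ∀ ζ : Fin n → ℂ, m * (star ζ ⬝ᵥ ζ).re ≤ quadForm (𝓗 ξ) ζ) (u : ℝ → Fin n → ℂ) :
    ∀ᵐ ξ ∂(volume.restrict (Set.Ioi (0 : ℝ))), ξ ≤ N →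
      quadForm (𝓗 ξ) ((𝓗 ξ)⁻¹ *ᵥ u ξ) ≤ m⁻¹ * (n * ‖u ξ‖ ^ 2) := by
  filter_upwards [hb, h.ae_mulVec_inv u] with ξ h1 h2 hξ
  have h3 := quadForm_le_mulVec_self hm _ (h1 hξ ((𝓗 ξ)⁻¹ *ᵥ u ξ))
  rw [← h2] at h3
  rw [← div_eq_inv_mul, le_div_iff₀' hm]
  exact h3.trans (dotProduct_self_le_sq_norm _)

/-- Compactly supported functions with square integrable derivative yield elements of the
domains of `A` and `A*`. -/
lemma IsWeight.repSemi_of_compact (h : IsWeight n 𝓗) {u g : ℝ → Fin n → ℂ} {N : ℝ}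
    (hg : MemLp g 2 (volume.restrict (Set.Ioi 0))) (hp : IsPrimitive u g)
    (hz : ∀ ξ, N ≤ ξ → u ξ = 0) (C D : Matrix (Fin n) (Fin n) ℂ) :
    RepSemi n 𝓗 (fun ξ => (𝓗 ξ)⁻¹ *ᵥ u ξ) u g ∧
      MemL2w n 𝓗 (Set.Ioi 0) (fun ξ => (𝓗 ξ)⁻¹ *ᵥ u ξ) ∧
      MemL2w n 𝓗 (Set.Ioi 0) (fun ξ => C *ᵥ g ξ + D *ᵥ u ξ) := by
  have hu : MemLp u 2 (volume.restrict (Set.Ioi 0)) := by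
    rw [memLp_two_iff_integrable_sq_norm hp.aestronglyMeasurable]
    have h1 : IntegrableOn (fun ξ => ‖u ξ‖ ^ 2) (Set.Icc 0 N) :=
      ((hp.continuousOn.mono Set.Icc_subset_Ici_self).norm.pow 2).integrableOn_Icc
    have h2 : IntegrableOn (fun ξ => ‖u ξ‖ ^ 2) (Set.Ioi N) := by
      refine (integrableOn_zero : IntegrableOn (fun _ => (0 : ℝ)) (Set.Ioi N) volume).congr_fun
        (fun ξ hξ => ?_) measurableSet_Ioi
      simp [hz ξ (le_of_lt hξ)]
    refine (h1.union h2).mono_set fun ξ hξ => ?_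
    rcases le_or_gt ξ N with h3 | h3
    · exact Or.inl ⟨le_of_lt hξ, h3⟩
    · exact Or.inr h3
  refine ⟨⟨h.ae_mulVec_inv u, hp.eq, h.memL2w_of_memLp hg⟩, ?_,
    h.memL2w_of_memLp ((memLp_mulVec_const C hg).add (memLp_mulVec_const D hu))⟩
  obtain ⟨m, hm, hb⟩ := h.loc N
  refine h.memL2w_of_le (h.aestronglyMeasurable_inv_mulVec hp.aestronglyMeasurable)
    ((((memLp_two_iff_integrable_sq_norm hu.1).1 hu).const_mul n).const_mul m⁻¹) ?_
  filter_upwards [h.quadForm_inv_mulVec_le hm hb u] with ξ h1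
  rcases le_or_gt ξ N with h3 | h3
  · exact h1 h3
  · simp [hz ξ h3.le, quadForm]

/-- Every vector is the boundary value of an element of the domain of `A*`. -/
lemma IsWeight.exists_boundary_value (h : IsWeight n 𝓗) (P1 P0 : Matrix (Fin n) (Fin n) ℂ)
    (a : Fin n → ℂ) : ∃ x y u g, AdjPair n 𝓗 P1 P0 x y u g ∧ RepSemi n 𝓗 x u g ∧ u 0 = a := by
  let g : ℝ → Fin n → ℂ := (Set.Ioc (0 : ℝ) 1).indicator fun _ => -a
  have hg : ∀ p, MemLp g p volume := fun p =>
    memLp_indicator_const p measurableSet_Ioc (-a) (Or.inr (by simp))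
  have hgi : ∀ s t, IntervalIntegrable g volume s t := fun s t =>
    (memLp_one_iff_integrable.1 (hg 1)).intervalIntegrable
  let u : ℝ → Fin n → ℂ := fun ξ => a + ∫ τ in (0 : ℝ)..ξ, g τ
  have u0 : u 0 = a := by simp [u]
  have hp : IsPrimitive u g := ⟨fun N _ => hgi 0 N, fun ξ _ => by rw [u0]⟩
  have hz : ∀ ξ, 1 ≤ ξ → u ξ = 0 := by
    intro ξ hξ
    have : ∫ τ in (0 : ℝ)..ξ, g τ = -a := by
      rw [intervalIntegral.integral_of_le (by linarith), setIntegral_indicator measurableSet_Ioc,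
        Set.Ioc_inter_Ioc]
      simp [hξ]
    simp only [u, this]
    simp
  obtain ⟨h1, h2, h3⟩ := h.repSemi_of_compact ((hg 2).restrict _) hp hz (-P1) (-P0)
  refine ⟨_, _, u, g, ⟨h2, h3, h1.1, hp, Filter.Eventually.of_forall fun ξ => ?_⟩, h1, u0⟩
  simp [neg_mulVec, sub_eq_add_neg]

end Semi

section Cell
variable {n : ℕ}

/-- A bounded interval splits into `k + 1` pieces carrying the same integral of `ρ ≥ 0`. -/
lemma exists_equipartition {a b : ℝ} (hab : a ≤ b) {ρ : ℝ → ℝ} (hρ : IntervalIntegrable ρ volume a b)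
    (h0 : ∀ᵐ x ∂(volume.restrict (Set.Ioc a b)), 0 ≤ ρ x) (hpos : 0 < ∫ x in a..b, ρ x) (k : ℕ) :
    ∃ t : ℕ → ℝ, (∀ i, i ≤ k + 1 → t i ∈ Set.Icc a b) ∧
      (∀ i j, i ≤ j → j ≤ k + 1 → t i ≤ t j) ∧
      ∀ i, i ≤ k → ∫ x in (t i)..(t (i + 1)), ρ x = (∫ x in a..b, ρ x) / (k + 1) := by
  set I := ∫ x in a..b, ρ x with hI
  have hk : (0 : ℝ) < k + 1 := by positivity
  have hsub : ∀ x ∈ Set.Icc a b, ∀ y ∈ Set.Icc a b, IntervalIntegrable ρ volume x y :=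
    fun x hx y hy => hρ.mono_set (by
      rw [Set.uIcc_of_le hab]; exact Set.uIcc_subset_Icc hx hy)
  have ha : a ∈ Set.Icc a b := ⟨le_rfl, hab⟩
  have hc : ContinuousOn (fun x => ∫ y in a..x, ρ y) (Set.Icc a b) := by
    have := intervalIntegral.continuousOn_primitive_interval' hρ Set.left_mem_uIcc
    rwa [Set.uIcc_of_le hab] at this
  have hmono : ∀ x ∈ Set.Icc a b, ∀ y ∈ Set.Icc a b, x ≤ y →
      ∫ z in a..x, ρ z ≤ ∫ z in a..y, ρ z := by
    intro x hx y hy hxy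
    rw [← intervalIntegral.integral_add_adjacent_intervals (hsub a ha x hx) (hsub x hx y hy)]
    have : 0 ≤ ∫ z in x..y, ρ z := by
      rw [intervalIntegral.integral_of_le hxy]
      refine integral_nonneg_of_ae (ae_mono (Measure.restrict_mono ?_ le_rfl) h0)
      exact Set.Ioc_subset_Ioc hx.1 hy.2
    linarith
  have hex : ∀ i : ℕ, ∃ x, i ≤ k + 1 → x ∈ Set.Icc a b ∧ ∫ y in a..x, ρ y = i * I / (k + 1) := by
    intro i
    by_cases hi : i ≤ k + 1
    · have hik : (i : ℝ) ≤ k + 1 := by exact_mod_cast hi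
      have hmem : (i * I / (k + 1) : ℝ) ∈ Set.Icc (∫ y in a..a, ρ y) (∫ y in a..b, ρ y) := by
        rw [intervalIntegral.integral_same]
        refine ⟨by positivity, ?_⟩
        rw [div_le_iff₀ hk, ← hI, mul_comm]
        gcongr
      obtain ⟨x, hx, hxe⟩ := intermediate_value_Icc hab hc hmem
      exact ⟨x, fun _ => ⟨hx, hxe⟩⟩
    · exact ⟨0, fun h => absurd h hi⟩
  choose t ht using hex
  refine ⟨t, fun i hi => (ht i hi).1, fun i j hij hj => ?_, fun i hi => ?_⟩
  · by_contra! hlt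
    obtain ⟨m1, e1⟩ := ht i (hij.trans hj)
    obtain ⟨m2, e2⟩ := ht j hj
    have h1 := hmono _ m2 _ m1 hlt.le
    rw [e1, e2, div_le_div_iff_of_pos_right hk, mul_le_mul_iff_left₀ hpos] at h1
    have h2 : j ≤ i := by exact_mod_cast h1
    rw [le_antisymm hij h2] at hlt
    exact lt_irrefl _ hlt
  · obtain ⟨m1, e1⟩ := ht i (by omega)
    obtain ⟨m2, e2⟩ := ht (i + 1) (by omega)
    rw [← intervalIntegral.integral_interval_sub_left (hsub a ha _ m2) (hsub a ha _ m1), e1, e2]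
    push_cast
    ring

lemma exists_normalized_relation (v : Fin (n + 1) → Fin n → ℂ) :
    ∃ c : Fin (n + 1) → ℂ, ∑ i, c i • v i = 0 ∧ (∀ i, ‖c i‖ ≤ 1) ∧ ∃ i, ‖c i‖ = 1 := by
  have hdep : ¬ LinearIndependent ℂ v := fun h => by
    have := h.fintype_card_le_finrank
    simp at this
  obtain ⟨c, hc, i, hi⟩ := Fintype.not_linearIndependent_iff.1 hdep
  obtain ⟨k, hk⟩ := Finite.exists_max fun i => ‖c i‖
  have hpos : 0 < ‖c k‖ := (norm_pos_iff.2 hi).trans_le (hk i)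
  refine ⟨fun i => (‖c k‖ : ℂ)⁻¹ * c i, ?_, fun i => ?_, k, ?_⟩
  · simp only [mul_smul, ← Finset.smul_sum, hc, smul_zero]
  · rw [norm_mul, norm_inv, Complex.norm_real, norm_norm, inv_mul_le_iff₀ hpos, mul_one]
    exact hk i
  · rw [norm_mul, norm_inv, Complex.norm_real, norm_norm, inv_mul_cancel₀ hpos.ne']

/-- A bounded scalar multiplier annihilating the integral of `f` while keeping a fixed proportion
of the mass of `ρ`. -/
lemma exists_multiplier {a b : ℝ} (hab : a ≤ b) {f : ℝ → Fin n → ℂ} {ρ : ℝ → ℝ}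
    (hf : IntervalIntegrable f volume a b) (hρ : IntervalIntegrable ρ volume a b)
    (h0 : ∀ᵐ x ∂(volume.restrict (Set.Ioc a b)), 0 ≤ ρ x) :
    ∃ s : ℝ → ℂ, Measurable s ∧ (∀ x, ‖s x‖ ≤ 1) ∧ ∫ x in a..b, s x • f x = 0 ∧
      ∫ x in a..b, ρ x ≤ (n + 1) * ∫ x in a..b, ‖s x‖ ^ 2 * ρ x := by
  rcases le_or_gt (∫ x in a..b, ρ x) 0 with hneg | hpos
  · exact ⟨fun _ => 0, measurable_const, by simp, by simp, by simpa using hneg⟩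
  obtain ⟨t, htm, hmono, hte⟩ := exists_equipartition hab hρ h0 hpos n
  let E : Fin (n + 1) → Set ℝ := fun i => Set.Ioc (t i) (t (i + 1))
  have hEsub : ∀ i, E i ⊆ Set.Ioc a b := fun i =>
    Set.Ioc_subset_Ioc (htm i (by omega)).1 (htm (i + 1) (by omega)).2
  have hEle : ∀ i : Fin (n + 1), t i ≤ t (i + 1) := fun i => hmono _ _ (by omega) (by omega)
  have hdisj : ∀ i j x, x ∈ E i → x ∈ E j → i = j := by
    intro i j x hi hj
    by_contra hne
    rcases lt_or_gt_of_ne hne with h | h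
    · have := hmono (i + 1) j (by omega) (by omega)
      exact absurd (hi.2.trans this) (not_le.2 hj.1)
    · have := hmono (j + 1) i (by omega) (by omega)
      exact absurd (hj.2.trans this) (not_le.2 hi.1)
  obtain ⟨c, hc0, hc1, k, hk⟩ := exists_normalized_relation fun i => ∫ x in E i, f x
  let s : ℝ → ℂ := fun x => ∑ i, (E i).indicator (fun _ => c i) x
  have hs : ∀ i x, x ∈ E i → s x = c i := by
    intro i x hx
    refine (Finset.sum_eq_single i (fun j _ hj => ?_) (by simp)).trans (Set.indicator_of_mem hx _)
    exact Set.indicator_of_notMem (fun hx' => hj (hdisj _ _ _ hx' hx)) _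
  have hs0 : ∀ x, (∀ i, x ∉ E i) → s x = 0 := fun x hx =>
    Finset.sum_eq_zero fun i _ => Set.indicator_of_notMem (hx i) _
  have hsm : Measurable s :=
    Finset.measurable_sum _ fun i _ => measurable_const.indicator measurableSet_Ioc
  have hs1 : ∀ x, ‖s x‖ ≤ 1 := by
    intro x
    by_cases hx : ∃ i, x ∈ E i
    · obtain ⟨i, hi⟩ := hx
      rw [hs i x hi]
      exact hc1 i
    · rw [hs0 x (not_exists.1 hx), norm_zero]
      exact zero_le_one
  rw [intervalIntegrable_iff_integrableOn_Ioc_of_le hab] at hf hρ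
  refine ⟨s, hsm, hs1, ?_, ?_⟩
  · rw [intervalIntegral.integral_of_le hab, ← hc0]
    have e : ∀ x, s x • f x = ∑ i, (E i).indicator (fun x => c i • f x) x := by
      intro x
      rw [Finset.sum_smul]
      refine Finset.sum_congr rfl fun i _ => ?_
      by_cases hx : x ∈ E i <;> simp [hx]
    simp only [e]
    rw [integral_finsetSum]
    · refine Finset.sum_congr rfl fun i _ => ?_
      rw [setIntegral_indicator measurableSet_Ioc, Set.inter_eq_right.2 (hEsub i), integral_smul]
    · exact fun i _ => (hf.smul (c i)).indicator measurableSet_Ioc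
  · have h1 : ∫ x in E k, ‖s x‖ ^ 2 * ρ x = (∫ x in a..b, ρ x) / (n + 1) := by
      rw [← hte k (by omega), intervalIntegral.integral_of_le (hEle k)]
      refine setIntegral_congr_fun measurableSet_Ioc fun x hx => ?_
      simp [hs k x hx, hk]
    have h2 : IntegrableOn (fun x => ‖s x‖ ^ 2 * ρ x) (Set.Ioc a b) := by
      refine Integrable.mono' hρ.norm ((hsm.norm.pow_const 2).aestronglyMeasurable.mul hρ.1)
        (Filter.Eventually.of_forall fun x => ?_)
      rw [norm_mul, Real.norm_eq_abs, abs_of_nonneg (by positivity)]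
      exact mul_le_of_le_one_left (norm_nonneg _) (pow_le_one₀ (norm_nonneg _) (hs1 x))
    have h3 : ∫ x in E k, ‖s x‖ ^ 2 * ρ x ≤ ∫ x in Set.Ioc a b, ‖s x‖ ^ 2 * ρ x := by
      refine setIntegral_mono_set h2 ?_ (Filter.Eventually.of_forall (hEsub k))
      filter_upwards [h0] with x hx
      exact mul_nonneg (by positivity) hx
    rw [h1, div_le_iff₀' (by positivity), ← intervalIntegral.integral_of_le hab] at h3
    exact h3

/-- Integrability on a countable union of cells by comparison of the integrals over each cell. -/
lemma integrableOn_iUnion_of_cell_le {E : ℕ → Set ℝ} (hE : ∀ j, MeasurableSet (E j))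
    (hd : Pairwise (Function.onFun Disjoint E)) {F G : ℝ → ℝ} {K : ℝ}
    (hF : ∀ j, IntegrableOn F (E j))
    (hF0 : ∀ᵐ x ∂(volume.restrict (⋃ j, E j)), 0 ≤ F x)
    (hG : IntegrableOn G (⋃ j, E j)) (hle : ∀ j, ∫ x in E j, F x ≤ K * ∫ x in E j, G x) :
    IntegrableOn F (⋃ j, E j) := by
  have hmono : ∀ j, ∀ᵐ x ∂(volume.restrict (E j)), 0 ≤ F x := fun j =>
    ae_mono (Measure.restrict_mono (Set.subset_iUnion E j) le_rfl) hF0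
  have e : ∀ j, ∫ x in E j, ‖F x‖ = ∫ x in E j, F x := fun j =>
    integral_congr_ae (by filter_upwards [hmono j] with x hx using abs_of_nonneg hx)
  refine integrableOn_iUnion_of_summable_integral_norm hF ?_
  simp only [e]
  exact Summable.of_nonneg_of_le (fun j => integral_nonneg_of_ae (hmono j)) hle
    ((hasSum_integral_iUnion hE hd hG).summable.mul_left K)

/-- A grid on `[0, ∞)` whose steps are controlled by prescribed positive numbers. -/
lemma exists_grid (m : ℕ → ℝ) (hm : ∀ N, 0 < m N) :
    ∃ a : ℕ → ℝ, a 0 = 0 ∧ StrictMono a ∧ ¬ BddAbove (Set.range a) ∧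
      ∀ j, ∃ N : ℕ, a (j + 1) ≤ N ∧ a (j + 1) - a j ≤ m N := by
  let l : ℝ → ℝ := fun x => min 1 (m ⌈x + 1⌉₊)
  have hl : ∀ x, 0 < l x := fun x => lt_min one_pos (hm _)
  let a : ℕ → ℝ := fun j => Nat.rec 0 (fun _ x => x + l x) j
  have hs : ∀ j, a (j + 1) = a j + l (a j) := fun j => rfl
  have hmono : StrictMono a := strictMono_nat_of_lt_succ fun j => by
    rw [hs]; linarith [hl (a j)]
  refine ⟨a, rfl, hmono, ?_, fun j => ⟨⌈a j + 1⌉₊, ?_, ?_⟩⟩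
  · rintro ⟨B, hB⟩
    obtain ⟨N, -, hN⟩ := Finset.exists_min_image (Finset.range (⌈B + 1⌉₊ + 1))
      (fun N => min 1 (m N)) ⟨0, by simp⟩
    set ε := min 1 (m N) with hε
    have hεpos : 0 < ε := lt_min one_pos (hm _)
    have hge : ∀ j : ℕ, j * ε ≤ a j := by
      intro j
      induction j with
      | zero => simp [a]
      | succ j ih =>
        have h1 : a j ≤ B := hB ⟨j, rfl⟩
        have h2 : ε ≤ l (a j) := hN _ (by
          rw [Finset.mem_range, Nat.lt_succ_iff]
          exact Nat.ceil_mono (by linarith))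
        rw [hs]
        push_cast
        linarith
    obtain ⟨j, hj⟩ := exists_nat_gt (B / ε)
    rw [div_lt_iff₀ hεpos] at hj
    linarith [hge j, hB ⟨j, rfl⟩]
  · rw [hs]
    exact le_trans (by gcongr; exact min_le_left _ _) (Nat.le_ceil _)
  · rw [hs, add_sub_cancel_left]
    exact min_le_right _ _

end Cell

section Oscillation
variable {n : ℕ} {𝓗 : ℝ → Matrix (Fin n) (Fin n) ℂ}

lemma sq_setIntegral_le {a b : ℝ} (hab : a < b) {φ : ℝ → ℝ} (h1 : IntegrableOn φ (Set.Ioc a b))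
    (h2 : IntegrableOn (fun x => φ x ^ 2) (Set.Ioc a b)) :
    (∫ x in Set.Ioc a b, φ x) ^ 2 ≤ (b - a) * ∫ x in Set.Ioc a b, φ x ^ 2 := by
  set A := ∫ x in Set.Ioc a b, φ x
  set B := ∫ x in Set.Ioc a b, φ x ^ 2
  have hpos : 0 < b - a := sub_pos.2 hab
  set c := A / (b - a) with hc
  have h3 : IntegrableOn (fun x => φ x ^ 2 - 2 * c * φ x) (Set.Ioc a b) :=
    h2.sub (h1.const_mul (2 * c))
  have key : ∫ x in Set.Ioc a b, (φ x ^ 2 - 2 * c * φ x + c ^ 2) =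
      B - 2 * c * A + c ^ 2 * (b - a) := by
    rw [integral_add h3 (by simp), integral_sub h2 (h1.const_mul _), integral_const_mul]
    simp [hpos.le, mul_comm, A, B]
  have h0 : 0 ≤ ∫ x in Set.Ioc a b, (φ x ^ 2 - 2 * c * φ x + c ^ 2) :=
    integral_nonneg fun x => by
      have : φ x ^ 2 - 2 * c * φ x + c ^ 2 = (φ x - c) ^ 2 := by ring
      simp only [Pi.zero_apply, this]
      positivity
  rw [key] at h0
  have hA : A = c * (b - a) := by rw [hc, div_mul_cancel₀ _ hpos.ne']
  nlinarith

lemma exists_sq_norm_mulVec_le (C : Matrix (Fin n) (Fin n) ℂ) :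
    ∃ κ : ℝ, 0 ≤ κ ∧ ∀ v, ‖C *ᵥ v‖ ^ 2 ≤ κ * ‖v‖ ^ 2 := by
  refine ⟨‖LinearMap.toContinuousLinearMap (Matrix.mulVecLin C)‖ ^ 2, by positivity, fun v => ?_⟩
  rw [← mul_pow]
  gcongr
  exact (LinearMap.toContinuousLinearMap (Matrix.mulVecLin C)).le_opNorm v

lemma IsWeight.integrableOn_quadForm_of_memLp (h : IsWeight n 𝓗) {x : ℝ → Fin n → ℂ} {N : ℝ}
    (hm : AEStronglyMeasurable x (volume.restrict (Set.Ioi 0)))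
    (hx : MemLp x 2 (volume.restrict (Set.Ioc 0 N))) :
    IntegrableOn (fun ξ => quadForm (𝓗 ξ) (x ξ)) (Set.Ioc 0 N) := by
  obtain ⟨M, hM, hb⟩ := h.bdd
  have hle : volume.restrict (Set.Ioc 0 N) ≤ volume.restrict (Set.Ioi (0 : ℝ)) :=
    Measure.restrict_mono Set.Ioc_subset_Ioi_self le_rfl
  refine Integrable.mono' (((memLp_two_iff_integrable_sq_norm hx.1).1 hx).const_mul (M * n))
    ((h.aestronglyMeasurable_quadForm hm).mono_measure hle) ?_
  filter_upwards [ae_mono hle hb, ae_mono hle h.nonneg] with ξ h1 h2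
  rw [Real.norm_eq_abs, abs_of_nonneg (h2.1 _), mul_assoc]
  refine (h1 _).trans ?_
  gcongr
  exact dotProduct_self_le_sq_norm _

/-- If multiplication by `Q` does not preserve `L²_𝓗`, this is witnessed by the derivative of a
function which vanishes at `0` and oscillates so fast that `𝓗⁻¹ C w` stays in `L²_𝓗`. -/
lemma IsWeight.exists_oscillating (h : IsWeight n 𝓗) {Q : Matrix (Fin n) (Fin n) ℂ}
    {f : ℝ → Fin n → ℂ} (hf : MemL2w n 𝓗 (Set.Ioi 0) f)
    (hQ : ¬ MemL2w n 𝓗 (Set.Ioi 0) (fun ξ => Q *ᵥ f ξ)) :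
    ∃ g w : ℝ → Fin n → ℂ, MemL2w n 𝓗 (Set.Ioi 0) g ∧
      ¬ MemL2w n 𝓗 (Set.Ioi 0) (fun ξ => Q *ᵥ g ξ) ∧ IsPrimitive w g ∧ w 0 = 0 ∧
      ∀ C : Matrix (Fin n) (Fin n) ℂ,
        MemL2w n 𝓗 (Set.Ioi 0) (fun ξ => (𝓗 ξ)⁻¹ *ᵥ (C *ᵥ w ξ)) := by
  choose m hm hb using fun N : ℕ => h.loc N
  obtain ⟨a, ha0, hmono, hunb, hgrid⟩ := exists_grid m hm
  let E : ℕ → Set ℝ := fun j => Set.Ioc (a j) (a (j + 1))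
  have hlt : ∀ j, a j < a (j + 1) := fun j => hmono (Nat.lt_succ_self j)
  have hnn : ∀ j, 0 ≤ a j := fun j => ha0 ▸ hmono.monotone (Nat.zero_le j)
  have hE : ∀ j, MeasurableSet (E j) := fun j => measurableSet_Ioc
  have hd : Pairwise (Function.onFun Disjoint E) := hmono.monotone.pairwise_disjoint_on_Ioc_succ
  have hU : ⋃ j, E j = Set.Ioi 0 := by
    have := iUnion_Ioc_map_succ_eq_Ioi (f := a) (fun j => hmono.monotone bot_le) hunb
    rwa [Nat.bot_eq_zero, ha0] at this
  have hEsub : ∀ j, E j ⊆ Set.Ioc 0 (a (j + 1)) := fun j => Set.Ioc_subset_Ioc_left (hnn j)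
  have hEsub' : ∀ j, E j ⊆ Set.Ioi 0 := fun j => (hEsub j).trans Set.Ioc_subset_Ioi_self
  have hEle : ∀ j, volume.restrict (E j) ≤ volume.restrict (Set.Ioi (0 : ℝ)) := fun j =>
    Measure.restrict_mono (hEsub' j) le_rfl
  have huniq : ∀ i j x, x ∈ E i → x ∈ E j → i = j := by
    intro i j x hi hj
    by_contra hne
    exact Set.disjoint_left.1 (hd hne) hi hj
  have hmem : ∀ x : ℝ, x ∈ Set.Ioi (0 : ℝ) → ∃ j, x ∈ E j := fun x hx => by
    rw [← hU] at hx
    exact Set.mem_iUnion.1 hx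
  set ρ : ℝ → ℝ := fun ξ => quadForm (𝓗 ξ) (Q *ᵥ f ξ) with hρdef
  have hQm : AEStronglyMeasurable (fun ξ => Q *ᵥ f ξ) (volume.restrict (Set.Ioi 0)) := by
    have hc : Continuous fun v : Fin n → ℂ => Q *ᵥ v := by fun_prop
    exact hc.comp_aestronglyMeasurable hf.1
  have hρ : ∀ j, IntegrableOn ρ (E j) := fun j =>
    (h.integrableOn_quadForm_of_memLp hQm
      (memLp_mulVec_const Q (h.memLp_Ioc hf (a (j + 1))))).mono_set (hEsub j)
  have hρ0 : ∀ᵐ ξ ∂(volume.restrict (Set.Ioi 0)), 0 ≤ ρ ξ := by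
    filter_upwards [h.nonneg] with ξ h1 using h1.1 _
  have hex : ∀ j, ∃ s : ℝ → ℂ, Measurable s ∧ (∀ x, ‖s x‖ ≤ 1) ∧
      ∫ x in (a j)..(a (j + 1)), s x • f x = 0 ∧
      ∫ x in E j, ρ x ≤ (n + 1) * ∫ x in E j, ‖s x‖ ^ 2 * ρ x := by
    intro j
    have hfj : IntervalIntegrable f volume (a j) (a (j + 1)) := by
      rw [intervalIntegrable_iff_integrableOn_Ioc_of_le (hlt j).le]
      have := (h.memLp_Ioc hf (a (j + 1))).integrable (by norm_num)
      exact IntegrableOn.mono_set this (hEsub j)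
    obtain ⟨s, h1, h2, h3, h4⟩ := exists_multiplier (hlt j).le hfj
      ((intervalIntegrable_iff_integrableOn_Ioc_of_le (hlt j).le).2 (hρ j))
      (ae_mono (hEle j) hρ0)
    rw [intervalIntegral.integral_of_le (hlt j).le, intervalIntegral.integral_of_le (hlt j).le] at h4
    exact ⟨s, h1, h2, h3, h4⟩
  choose s hsm hs1 hs0 hsρ using hex
  classical
  let g : ℝ → Fin n → ℂ := fun ξ => if hξ : ∃ j, ξ ∈ E j then s hξ.choose ξ • f ξ else 0
  have hg : ∀ j, Set.EqOn g (fun ξ => s j ξ • f ξ) (E j) := by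
    intro j ξ hξ
    have hξ' : ∃ j, ξ ∈ E j := ⟨j, hξ⟩
    simp only [g, dif_pos hξ', huniq _ _ _ hξ'.choose_spec hξ]
  have hgm : AEStronglyMeasurable g (volume.restrict (Set.Ioi 0)) := by
    rw [← hU, aestronglyMeasurable_iUnion_iff]
    intro j
    refine AEStronglyMeasurable.congr ((hsm j).aestronglyMeasurable.smul
      (hf.1.mono_measure (hEle j))) ?_
    filter_upwards [ae_restrict_mem (hE j)] with ξ hξ using (hg j hξ).symm
  have hgq : ∀ j ξ, ξ ∈ E j → ∀ D : Matrix (Fin n) (Fin n) ℂ,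
      quadForm (𝓗 ξ) (D *ᵥ g ξ) = ‖s j ξ‖ ^ 2 * quadForm (𝓗 ξ) (D *ᵥ f ξ) := by
    intro j ξ hξ D
    rw [hg j hξ, mulVec_smul, quadForm_smul]
  have hgmem : MemL2w n 𝓗 (Set.Ioi 0) g := by
    refine h.memL2w_of_le hgm hf.2 ?_
    filter_upwards [h.nonneg, ae_restrict_mem measurableSet_Ioi] with ξ h1 h2
    obtain ⟨j, hj⟩ := hmem ξ h2
    have := hgq j ξ hj 1
    rw [one_mulVec, one_mulVec] at this
    rw [this]
    exact mul_le_of_le_one_left (h1.1 _) (pow_le_one₀ (norm_nonneg _) (hs1 j ξ))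
  have hQg : ¬ MemL2w n 𝓗 (Set.Ioi 0) (fun ξ => Q *ᵥ g ξ) := by
    intro hcon
    refine hQ ⟨hQm, ?_⟩
    have hG : IntegrableOn (fun ξ => quadForm (𝓗 ξ) (Q *ᵥ g ξ)) (⋃ j, E j) := by
      rw [hU]; exact hcon.2
    have := integrableOn_iUnion_of_cell_le hE hd hρ (by rw [hU]; exact hρ0) hG (K := n + 1)
      fun j => by
        rw [setIntegral_congr_fun (hE j) fun ξ hξ => hgq j ξ hξ Q]
        exact hsρ j
    rw [hU] at this
    exact this
  let w : ℝ → Fin n → ℂ := fun ξ => ∫ τ in (0 : ℝ)..ξ, g τ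
  have hw0 : w 0 = 0 := by simp [w]
  have hp : IsPrimitive w g := ⟨fun N hN => h.intervalIntegrable hgmem hN, fun ξ _ => by
    rw [hw0, zero_add]⟩
  have hgi : ∀ x y : ℝ, 0 ≤ x → 0 ≤ y → IntervalIntegrable g volume x y := fun x y hx hy =>
    (hp.int x hx).symm.trans (hp.int y hy)
  have hwa : ∀ j, w (a j) = 0 := by
    intro j
    induction j with
    | zero => rw [ha0, hw0]
    | succ j ih =>
      have h1 : w (a (j + 1)) = w (a j) + ∫ τ in (a j)..(a (j + 1)), g τ :=
        (intervalIntegral.integral_add_adjacent_intervals (hp.int _ (hnn j))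
          (hgi _ _ (hnn j) (hnn (j + 1)))).symm
      rw [h1, ih, zero_add, ← hs0 j, intervalIntegral.integral_of_le (hlt j).le,
        intervalIntegral.integral_of_le (hlt j).le]
      exact setIntegral_congr_fun (hE j) (hg j)
  have hgsq : ∀ j, IntegrableOn (fun ξ => ‖g ξ‖ ^ 2) (E j) := fun j => by
    have h1 := h.memLp_Ioc hgmem (a (j + 1))
    exact IntegrableOn.mono_set ((memLp_two_iff_integrable_sq_norm h1.1).1 h1) (hEsub j)
  have hw : ∀ j ξ, ξ ∈ E j → ‖w ξ‖ ^ 2 ≤ (a (j + 1) - a j) * ∫ τ in E j, ‖g τ‖ ^ 2 := by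
    intro j ξ hξ
    have hξ0 : 0 ≤ ξ := (hnn j).trans hξ.1.le
    have hgn : IntegrableOn (fun τ => ‖g τ‖) (E j) :=
      ((intervalIntegrable_iff_integrableOn_Ioc_of_le (hlt j).le).1
        (hgi _ _ (hnn j) (hnn (j + 1)))).norm
    have h1 : w ξ = w (a j) + ∫ τ in (a j)..ξ, g τ :=
      (intervalIntegral.integral_add_adjacent_intervals (hp.int _ (hnn j))
        (hgi _ _ (hnn j) hξ0)).symm
    have h2 : ‖w ξ‖ ≤ ∫ τ in E j, ‖g τ‖ := by
      rw [h1, hwa, zero_add, intervalIntegral.integral_of_le hξ.1.le]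
      refine (norm_integral_le_integral_norm _).trans ?_
      exact setIntegral_mono_set hgn (Filter.Eventually.of_forall fun _ => norm_nonneg _)
        (Filter.Eventually.of_forall (Set.Ioc_subset_Ioc_right hξ.2))
    exact (pow_le_pow_left₀ (norm_nonneg _) h2 2).trans (sq_setIntegral_le (hlt j) hgn (hgsq j))
  refine ⟨g, w, hgmem, hQg, hp, hw0, fun C => ?_⟩
  obtain ⟨κ, hκ, hC⟩ := exists_sq_norm_mulVec_le C
  have hCm : AEStronglyMeasurable (fun ξ => C *ᵥ w ξ) (volume.restrict (Set.Ioi 0)) := by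
    have hc : Continuous fun v : Fin n → ℂ => C *ᵥ v := by fun_prop
    exact hc.comp_aestronglyMeasurable hp.aestronglyMeasurable
  have hFm := h.aestronglyMeasurable_inv_mulVec hCm
  refine ⟨hFm, ?_⟩
  have hG0 : ∀ j, 0 ≤ ∫ τ in E j, quadForm (𝓗 τ) (g τ) := fun j =>
    integral_nonneg_of_ae (ae_mono (hEle j) (by filter_upwards [h.nonneg] with ξ h1 using h1.1 _))
  have hF0 : ∀ᵐ ξ ∂(volume.restrict (Set.Ioi 0)),
      0 ≤ quadForm (𝓗 ξ) ((𝓗 ξ)⁻¹ *ᵥ (C *ᵥ w ξ)) := by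
    filter_upwards [h.nonneg] with ξ h1 using h1.1 _
  have hpt : ∀ j, ∃ c : ℝ, (a (j + 1) - a j) * c ≤ n * κ * ∫ τ in E j, quadForm (𝓗 τ) (g τ) ∧
      ∀ᵐ ξ ∂(volume.restrict (E j)), quadForm (𝓗 ξ) ((𝓗 ξ)⁻¹ *ᵥ (C *ᵥ w ξ)) ≤ c := by
    intro j
    obtain ⟨N, hN, hδ⟩ := hgrid j
    set δ := a (j + 1) - a j with hδdef
    have hδ0 : 0 < δ := sub_pos.2 (hlt j)
    have hgG : m N * ∫ τ in E j, ‖g τ‖ ^ 2 ≤ ∫ τ in E j, quadForm (𝓗 τ) (g τ) := by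
      rw [← integral_const_mul]
      refine setIntegral_mono_ae_restrict ((hgsq j).const_mul _)
        (IntegrableOn.mono_set hgmem.2 (hEsub' j)) ?_
      filter_upwards [ae_mono (hEle j) (hb N), ae_restrict_mem (hE j)] with ξ h1 h2
      exact le_trans (mul_le_mul_of_nonneg_left (sq_norm_le_dotProduct_self _) (hm N).le)
        (h1 (h2.2.trans hN) _)
    set G := ∫ τ in E j, quadForm (𝓗 τ) (g τ)
    set B := ∫ τ in E j, ‖g τ‖ ^ 2
    have hB0 : 0 ≤ B := integral_nonneg fun _ => by positivity
    refine ⟨(m N)⁻¹ * (n * (κ * (δ * B))), ?_, ?_⟩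
    · calc δ * ((m N)⁻¹ * (n * (κ * (δ * B)))) = (m N)⁻¹ * δ * (n * κ * (δ * B)) := by ring
        _ ≤ 1 * (n * κ * (m N * B)) := by
          gcongr
          rw [inv_mul_le_iff₀ (hm N), mul_one]
          exact hδ
        _ ≤ n * κ * G := by
          rw [one_mul]
          gcongr
    · filter_upwards [ae_mono (hEle j) (h.quadForm_inv_mulVec_le (hm N) (hb N) fun ξ => C *ᵥ w ξ),
        ae_restrict_mem (hE j)] with ξ h1 h2
      refine (h1 (h2.2.trans hN)).trans ?_
      have hmN := hm N
      gcongr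
      exact (hC _).trans (by gcongr; exact hw j ξ h2)
  have hvol : ∀ j, volume.real (E j) = a (j + 1) - a j := fun j => by
    simp [E, (hlt j).le]
  have hFi : ∀ j, IntegrableOn (fun ξ => quadForm (𝓗 ξ) ((𝓗 ξ)⁻¹ *ᵥ (C *ᵥ w ξ))) (E j) := by
    intro j
    obtain ⟨c, -, hc⟩ := hpt j
    refine Integrable.mono' (g := fun _ => c) (by simp [E])
      ((h.aestronglyMeasurable_quadForm hFm).mono_measure (hEle j)) ?_
    filter_upwards [hc, ae_mono (hEle j) hF0] with ξ h1 h2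
    rw [Real.norm_eq_abs]
    exact (abs_of_nonneg h2).trans_le h1
  have := integrableOn_iUnion_of_cell_le hE hd hFi (by rw [hU]; exact hF0)
    (by rw [hU]; exact hgmem.2) (K := n * κ) fun j => by
      obtain ⟨c, hc1, hc⟩ := hpt j
      refine le_trans ?_ hc1
      have h1 := setIntegral_mono_ae_restrict (hFi j) (by simp [E]) hc
      rwa [setIntegral_const, hvol, smul_eq_mul] at h1
  rw [hU] at this
  exact this

end Oscillation

section Adjoint
variable {n : ℕ} {𝓗 : ℝ → Matrix (Fin n) (Fin n) ℂ}

lemma GraphASemi.exists_adjPair (h : IsWeight n 𝓗) {P1 P0 : Matrix (Fin n) (Fin n) ℂ}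
    {z w : ℝ → Fin n → ℂ} (hG : GraphASemi n 𝓗 P1 P0 z w) :
    ∃ u g, AdjPair n 𝓗 P1 P0 z (fun ξ => -(w ξ)) u g ∧ u 0 = 0 := by
  obtain ⟨hz, hw, u, g, hr, hu0, he⟩ := hG
  refine ⟨u, g, ⟨hz, memL2w_neg hw, hr.1, hr.isPrimitive h, ?_⟩, hu0⟩
  filter_upwards [he] with ξ h1
  rw [h1]
  abel

lemma IsWeight.wip_add_smul (h : IsWeight n 𝓗) {x y z w : ℝ → Fin n → ℂ}
    (hx : MemL2w n 𝓗 (Set.Ioi 0) x) (hy : MemL2w n 𝓗 (Set.Ioi 0) y)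
    (hz : MemL2w n 𝓗 (Set.Ioi 0) z) (hw : MemL2w n 𝓗 (Set.Ioi 0) w) (c : ℝ) :
    wip n 𝓗 (Set.Ioi 0) (fun ξ => y ξ + (c : ℂ) • w ξ) (fun ξ => x ξ + (c : ℂ) • z ξ) =
      wip n 𝓗 (Set.Ioi 0) y x + c * (wip n 𝓗 (Set.Ioi 0) y z + wip n 𝓗 (Set.Ioi 0) w x) +
        c ^ 2 * wip n 𝓗 (Set.Ioi 0) w z := by
  have i1 := h.integrable_sesq hx hy
  have i2 := h.integrable_sesq hz hy
  have i3 := h.integrable_sesq hx hw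
  have i4 := h.integrable_sesq hz hw
  have i5 : IntegrableOn (fun ξ => (c : ℂ) * (star (y ξ) ⬝ᵥ (𝓗 ξ *ᵥ z ξ) +
      star (w ξ) ⬝ᵥ (𝓗 ξ *ᵥ x ξ))) (Set.Ioi 0) := (i2.add i3).const_mul _
  have i6 : IntegrableOn (fun ξ => star (y ξ) ⬝ᵥ (𝓗 ξ *ᵥ x ξ) + (c : ℂ) *
      (star (y ξ) ⬝ᵥ (𝓗 ξ *ᵥ z ξ) + star (w ξ) ⬝ᵥ (𝓗 ξ *ᵥ x ξ))) (Set.Ioi 0) := i1.add i5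
  simp only [wip]
  rw [← integral_add i2 i3, ← integral_const_mul, ← integral_const_mul, ← integral_add i1 i5,
    ← integral_add i6 (i4.const_mul _)]
  refine integral_congr_ae (Filter.Eventually.of_forall fun ξ => ?_)
  have e : star (c : ℂ) = c := Complex.conj_ofReal c
  simp only [star_add, star_smul, e, mulVec_add, mulVec_smul, add_dotProduct, dotProduct_add,
    smul_dotProduct, dotProduct_smul, smul_eq_mul]
  ring

/-- The vanishing of the cross term: a dissipative extension of `-A` is a restriction of the
adjoint, in weak form. -/
lemma IsWeight.wip_comm_of_dissipRel (h : IsWeight n 𝓗) {P1 P0 : Matrix (Fin n) (Fin n) ℂ}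
    (hP1 : P1.IsHermitian) (hP0 : P0.conjTranspose = -P0)
    {K : (ℝ → Fin n → ℂ) → (ℝ → Fin n → ℂ) → Prop} (hK : IsOpRel n 𝓗 K)
    (hKd : DissipRel n 𝓗 K) (hKA : ∀ z w, GraphASemi n 𝓗 P1 P0 z w → K z (fun ξ => -(w ξ)))
    {x y z w : ℝ → Fin n → ℂ} (hxy : K x y) (hzw : GraphASemi n 𝓗 P1 P0 z w) :
    (wip n 𝓗 (Set.Ioi 0) y z).re = (wip n 𝓗 (Set.Ioi 0) w x).re := by
  obtain ⟨u, g, hp, hu0⟩ := hzw.exists_adjPair h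
  have h0 := hp.green h hP1 hP0
  rw [hu0] at h0
  obtain ⟨hx, hy⟩ := hK.1 _ _ hxy
  have key : ∀ c : ℝ, (wip n 𝓗 (Set.Ioi 0) y x).re + c * ((wip n 𝓗 (Set.Ioi 0) y z).re +
      (wip n 𝓗 (Set.Ioi 0) (fun ξ => -(w ξ)) x).re) ≤ 0 := by
    intro c
    have h1 := hKd _ _ (hK.2.2.1 _ _ _ _ hxy (hK.2.2.2.1 (c : ℂ) _ _ (hKA _ _ hzw)))
    rw [h.wip_add_smul hx hy hp.left hp.right c] at h1
    rw [← Complex.ofReal_pow, Complex.add_re, Complex.add_re, Complex.re_ofReal_mul,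
      Complex.re_ofReal_mul, h0, Complex.add_re] at h1
    simpa [quadForm] using h1
  have hneg : wip n 𝓗 (Set.Ioi 0) (fun ξ => -(w ξ)) x = -wip n 𝓗 (Set.Ioi 0) w x := by
    simp only [wip, star_neg, neg_dotProduct, integral_neg]
  rw [hneg, Complex.neg_re] at key
  set α := (wip n 𝓗 (Set.Ioi 0) y x).re
  set β := (wip n 𝓗 (Set.Ioi 0) y z).re
  set γ := (wip n 𝓗 (Set.Ioi 0) w x).re
  by_contra hne
  have hne' : β + -γ ≠ 0 := fun h3 => hne (by linarith)
  have := key ((1 - α) / (β + -γ))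
  rw [div_mul_cancel₀ _ hne'] at this
  linarith

lemma integrable_re_star_dotProduct {μ : Measure ℝ} {f g : ℝ → Fin n → ℂ} (hf : MemLp f 2 μ)
    (hg : MemLp g 2 μ) : Integrable (fun ξ => (star (f ξ) ⬝ᵥ g ξ).re) μ := by
  have hc : Continuous fun p : (Fin n → ℂ) × (Fin n → ℂ) => (star p.1 ⬝ᵥ p.2).re := by fun_prop
  have hm := hc.comp_aestronglyMeasurable (hf.1.prodMk hg.1)
  have hm' : AEStronglyMeasurable (fun ξ => (star (f ξ) ⬝ᵥ g ξ).re) μ := hm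
  have hF : Integrable (fun ξ => (n : ℝ) * (‖f ξ‖ ^ 2 + ‖g ξ‖ ^ 2)) μ :=
    (((memLp_two_iff_integrable_sq_norm hf.1).1 hf).add
      ((memLp_two_iff_integrable_sq_norm hg.1).1 hg)).const_mul _
  refine Integrable.mono' hF hm' (Filter.Eventually.of_forall fun ξ => ?_)
  refine (Complex.abs_re_le_norm _).trans ((norm_dotProduct_le _ _).trans ?_)
  rw [norm_star]
  gcongr
  nlinarith [sq_nonneg (‖f ξ‖ - ‖g ξ‖), sq_nonneg ‖f ξ‖, sq_nonneg ‖g ξ‖]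

/-- The fundamental lemma of the calculus of variations in the form needed here. -/
lemma exists_ae_eq_const_of_orthogonal {N : ℝ} (hN : 0 < N) {v : ℝ → Fin n → ℂ}
    (hv : MemLp v 2 (volume.restrict (Set.Ioc 0 N)))
    (horth : ∀ g : ℝ → Fin n → ℂ, MemLp g 2 volume → (∀ ξ, ξ ∉ Set.Ioc 0 N → g ξ = 0) →
      ∫ ξ in Set.Ioc 0 N, g ξ = 0 → ∫ ξ in Set.Ioc 0 N, (star (g ξ) ⬝ᵥ v ξ).re = 0) :
    ∃ c, ∀ᵐ ξ ∂(volume.restrict (Set.Ioc 0 N)), v ξ = c := by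
  set c : Fin n → ℂ := N⁻¹ • ∫ ξ in Set.Ioc 0 N, v ξ with hc
  have hd : MemLp (fun ξ => v ξ - c) 2 (volume.restrict (Set.Ioc 0 N)) :=
    hv.sub (memLp_const c)
  have hdi : IntegrableOn (fun ξ => v ξ - c) (Set.Ioc 0 N) := hd.integrable (by norm_num)
  have hvi : IntegrableOn v (Set.Ioc 0 N) := hv.integrable (by norm_num)
  have hd0 : ∫ ξ in Set.Ioc 0 N, (v ξ - c) = 0 := by
    rw [integral_sub hvi (by simp), setIntegral_const, Real.volume_real_Ioc_of_le hN.le, sub_zero,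
      hc, smul_inv_smul₀ hN.ne', sub_self]
  have h1 := horth ((Set.Ioc 0 N).indicator fun ξ => v ξ - c)
    ((memLp_indicator_iff_restrict measurableSet_Ioc).2 hd)
    (fun ξ hξ => Set.indicator_of_notMem hξ _)
    (by rw [setIntegral_indicator measurableSet_Ioc, Set.inter_self, hd0])
  have h2 : ∫ ξ in Set.Ioc 0 N, (star (v ξ - c) ⬝ᵥ v ξ).re = 0 := by
    refine Eq.trans ?_ h1
    refine setIntegral_congr_fun measurableSet_Ioc fun ξ hξ => ?_
    simp only [Set.indicator_of_mem hξ]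
  let L : (Fin n → ℂ) →ₗ[ℂ] ℂ :=
    { toFun := fun a => star c ⬝ᵥ a
      map_add' := fun a b => dotProduct_add _ a b
      map_smul' := fun r a => dotProduct_smul r _ a }
  have hLi : IntegrableOn (fun ξ => star c ⬝ᵥ (v ξ - c)) (Set.Ioc 0 N) :=
    (LinearMap.toContinuousLinearMap L).integrable_comp hdi
  have h3 : ∫ ξ in Set.Ioc 0 N, (star c ⬝ᵥ (v ξ - c)).re = 0 := by
    have e := (LinearMap.toContinuousLinearMap L).integral_comp_comm hdi
    rw [hd0, map_zero] at e
    have e2 := Complex.reCLM.integral_comp_comm hLi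
    exact e2.trans ((congrArg Complex.re e).trans rfl)
  have hsq := (memLp_two_iff_integrable_sq_norm hd.1).1 hd
  have hm : AEStronglyMeasurable (fun ξ => (star (v ξ - c) ⬝ᵥ (v ξ - c)).re)
      (volume.restrict (Set.Ioc 0 N)) := by
    have hcont : Continuous fun a : Fin n → ℂ => (star a ⬝ᵥ a).re := by fun_prop
    exact hcont.comp_aestronglyMeasurable hd.1
  have hi : IntegrableOn (fun ξ => (star (v ξ - c) ⬝ᵥ (v ξ - c)).re) (Set.Ioc 0 N) := by
    refine Integrable.mono' (hsq.const_mul n) hm (Filter.Eventually.of_forall fun ξ => ?_)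
    rw [Real.norm_eq_abs, abs_of_nonneg ((sq_nonneg _).trans (sq_norm_le_dotProduct_self _))]
    exact dotProduct_self_le_sq_norm _
  have hsplit : ∀ ξ, (star (v ξ - c) ⬝ᵥ v ξ).re =
      (star (v ξ - c) ⬝ᵥ (v ξ - c)).re + (star c ⬝ᵥ (v ξ - c)).re := by
    intro ξ
    have e : (star c ⬝ᵥ (v ξ - c)).re = (star (v ξ - c) ⬝ᵥ c).re := by
      rw [star_dotProduct, ← Complex.conj_re, starRingEnd_apply, star_star]
    rw [e, ← Complex.add_re, ← dotProduct_add, sub_add_cancel]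
  simp only [hsplit] at h2
  have hLr : IntegrableOn (fun ξ => (star c ⬝ᵥ (v ξ - c)).re) (Set.Ioc 0 N) := hLi.re
  rw [integral_add hi hLr, h3, add_zero] at h2
  rw [integral_eq_zero_iff_of_nonneg
    (fun ξ => (sq_nonneg _).trans (sq_norm_le_dotProduct_self _)) hi] at h2
  refine ⟨c, ?_⟩
  filter_upwards [h2] with ξ h4
  have h5 := sq_norm_le_dotProduct_self (v ξ - c)
  rw [h4] at h5
  have h6 : ‖v ξ - c‖ = 0 := by
    have : ‖v ξ - c‖ ^ 2 = 0 := le_antisymm h5 (sq_nonneg _)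
    exact pow_eq_zero_iff two_ne_zero |>.1 this
  exact sub_eq_zero.1 (norm_eq_zero.1 h6)

lemma exists_ae_eq_const_Ioi {v : ℝ → Fin n → ℂ}
    (hv : ∀ N : ℕ, 0 < N → ∃ c, ∀ᵐ ξ ∂(volume.restrict (Set.Ioc (0 : ℝ) N)), v ξ = c) :
    ∃ c, ∀ᵐ ξ ∂(volume.restrict (Set.Ioi (0 : ℝ))), v ξ = c := by
  choose c hc using hv
  have key : ∀ N (hN : 0 < N), c N hN = c 1 one_pos := by
    intro N hN
    have hle : volume.restrict (Set.Ioc (0 : ℝ) (1 : ℕ)) ≤ volume.restrict (Set.Ioc (0 : ℝ) N) :=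
      Measure.restrict_mono (Set.Ioc_subset_Ioc_right (by exact_mod_cast hN)) le_rfl
    have hne : (ae (volume.restrict (Set.Ioc (0 : ℝ) (1 : ℕ)))).NeBot := by
      rw [ae_neBot, Ne, Measure.restrict_eq_zero]
      simp
    have e1 : ∀ᵐ ξ ∂(volume.restrict (Set.Ioc (0 : ℝ) (1 : ℕ))), v ξ = c N hN :=
      ae_mono hle (hc N hN)
    obtain ⟨ξ, h1, h2⟩ := (e1.and (hc 1 one_pos)).exists
    rw [← h1, ← h2]
  refine ⟨c 1 one_pos, ?_⟩
  rw [ae_restrict_iff' measurableSet_Ioi]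
  have h1 : ∀ N : ℕ, ∀ᵐ ξ : ℝ, ξ ∈ Set.Ioc (0 : ℝ) (N + 1 : ℕ) → v ξ = c (N + 1) N.succ_pos :=
    fun N => (ae_restrict_iff' measurableSet_Ioc).1 (hc _ _)
  filter_upwards [ae_all_iff.2 h1] with ξ h2 hξ
  obtain ⟨N, hN⟩ := exists_nat_ge ξ
  rw [h2 N ⟨hξ, hN.trans (by simp)⟩, key]

/-- Dissipative extensions of `-A` are restrictions of the adjoint, the derivative being only
locally integrable. -/
lemma IsWeight.exists_adjPair_of_dissipRel (h : IsWeight n 𝓗) {P1 P0 : Matrix (Fin n) (Fin n) ℂ}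
    (hP1 : P1.IsHermitian) (hP1inv : IsUnit P1) (hP0 : P0.conjTranspose = -P0)
    {K : (ℝ → Fin n → ℂ) → (ℝ → Fin n → ℂ) → Prop} (hK : IsOpRel n 𝓗 K)
    (hKd : DissipRel n 𝓗 K) (hKA : ∀ z w, GraphASemi n 𝓗 P1 P0 z w → K z (fun ξ => -(w ξ)))
    {x y : ℝ → Fin n → ℂ} (hxy : K x y) : ∃ u g, AdjPair n 𝓗 P1 P0 x y u g := by
  obtain ⟨hx, hy⟩ := hK.1 _ _ hxy
  set b : ℝ → Fin n → ℂ := fun ξ => 𝓗 ξ *ᵥ x ξ with hbdef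
  have hb : MemLp b 2 (volume.restrict (Set.Ioi 0)) := h.memLp_mulVec hx
  have hle : ∀ N : ℝ, volume.restrict (Set.Ioc 0 N) ≤ volume.restrict (Set.Ioi (0 : ℝ)) :=
    fun N => Measure.restrict_mono Set.Ioc_subset_Ioi_self le_rfl
  set k : ℝ → Fin n → ℂ := fun ξ => y ξ + P0 *ᵥ b ξ with hkdef
  have hk : ∀ N : ℝ, 0 ≤ N → IntervalIntegrable k volume 0 N := fun N hN => by
    refine (h.intervalIntegrable hy hN).add ?_
    rw [intervalIntegrable_iff_integrableOn_Ioc_of_le hN]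
    exact ((memLp_mulVec_const P0 hb).mono_measure (hle N)).integrable (by norm_num)
  set W : ℝ → Fin n → ℂ := fun ξ => ∫ τ in (0 : ℝ)..ξ, k τ with hWdef
  have hW0 : W 0 = 0 := by simp [W]
  have hW : IsPrimitive W k := ⟨hk, fun ξ _ => by rw [hW0, zero_add]⟩
  set v : ℝ → Fin n → ℂ := fun ξ => W ξ + P1 *ᵥ b ξ with hvdef
  have hvconst : ∃ c, ∀ᵐ ξ ∂(volume.restrict (Set.Ioi (0 : ℝ))), v ξ = c := by
    refine exists_ae_eq_const_Ioi fun N hN0 => ?_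
    have hN : (0 : ℝ) < N := by exact_mod_cast hN0
    have hWN : MemLp W 2 (volume.restrict (Set.Ioc (0 : ℝ) N)) := by
      rw [memLp_two_iff_integrable_sq_norm (hW.aestronglyMeasurable.mono_measure (hle N))]
      exact ((hW.continuousOn.mono
        Set.Icc_subset_Ici_self).norm.pow 2).integrableOn_Icc.mono_set Set.Ioc_subset_Icc_self
    refine exists_ae_eq_const_of_orthogonal hN
      (hWN.add ((memLp_mulVec_const P1 hb).mono_measure (hle N))) fun g hg hgz hg0 => ?_
    have hgi : ∀ s t, IntervalIntegrable g volume s t := fun s t => by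
      rw [intervalIntegrable_iff]
      have : IsFiniteMeasure (volume.restrict (Set.uIoc s t)) := ⟨by simp [Set.uIoc]⟩
      exact (hg.restrict _).integrable (by norm_num)
    set φ : ℝ → Fin n → ℂ := fun ξ => ∫ τ in (0 : ℝ)..ξ, g τ with hφdef
    have hφ0 : φ 0 = 0 := by simp [φ]
    have hφ : IsPrimitive φ g := ⟨fun M _ => hgi 0 M, fun ξ _ => by rw [hφ0, zero_add]⟩
    have hφz : ∀ ξ, (N : ℝ) ≤ ξ → φ ξ = 0 := by
      intro ξ hξ
      simp only [φ]
      rw [← intervalIntegral.integral_add_adjacent_intervals (hgi 0 N) (hgi N ξ),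
        intervalIntegral.integral_of_le hN.le, hg0, zero_add, intervalIntegral.integral_of_le hξ]
      refine setIntegral_eq_zero_of_forall_eq_zero fun τ hτ => hgz τ fun h1 => ?_
      exact absurd h1.2 (not_le.2 hτ.1)
    obtain ⟨hr, hz, hw⟩ := h.repSemi_of_compact (hg.restrict _) hφ hφz P1 P0
    have hzw : GraphASemi n 𝓗 P1 P0 (fun ξ => (𝓗 ξ)⁻¹ *ᵥ φ ξ)
        (fun ξ => P1 *ᵥ g ξ + P0 *ᵥ φ ξ) :=
      ⟨hz, hw, φ, g, hr, hφ0, Filter.Eventually.of_forall fun _ => rfl⟩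
    have key := h.wip_comm_of_dissipRel hP1 hP0 hK hKd hKA hxy hzw
    have i1 := h.integrable_sesq hz hy
    have i2 := h.integrable_sesq hx hw
    obtain ⟨j1, j2, j3⟩ := integral_deriv_dotProduct (1 : Matrix (Fin n) (Fin n) ℂ) hN.le
      (hφ.int N hN.le) (hk N hN.le) (fun ξ hξ => hφ.eq ξ hξ.1) (fun ξ hξ => hW.eq ξ hξ.1)
    rw [hφz N le_rfl, hφ0] at j3
    simp only [one_mulVec, star_zero, zero_dotProduct, sub_zero] at j1 j2 j3
    have c1 := Complex.reCLM.integral_comp_comm i1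
    have c2 := Complex.reCLM.integral_comp_comm i2
    have c3 : ∫ ξ in Set.Ioc (0 : ℝ) N, (star (g ξ) ⬝ᵥ W ξ + star (φ ξ) ⬝ᵥ k ξ).re = 0 := by
      have := Complex.reCLM.intervalIntegral_comp_comm (j1.add j2)
      rw [j3, map_zero, intervalIntegral.integral_of_le hN.le] at this
      exact this
    have c4 : ∫ ξ in Set.Ioi (0 : ℝ), ((star (y ξ) ⬝ᵥ (𝓗 ξ *ᵥ ((𝓗 ξ)⁻¹ *ᵥ φ ξ))).re -
        (star (P1 *ᵥ g ξ + P0 *ᵥ φ ξ) ⬝ᵥ (𝓗 ξ *ᵥ x ξ)).re) = 0 := by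
      have i1r : IntegrableOn (fun ξ => (star (y ξ) ⬝ᵥ (𝓗 ξ *ᵥ ((𝓗 ξ)⁻¹ *ᵥ φ ξ))).re)
        (Set.Ioi 0) := i1.re
      have i2r : IntegrableOn (fun ξ => (star (P1 *ᵥ g ξ + P0 *ᵥ φ ξ) ⬝ᵥ (𝓗 ξ *ᵥ x ξ)).re)
        (Set.Ioi 0) := i2.re
      rw [integral_sub i1r i2r]
      refine sub_eq_zero.2 ((c1.trans key).trans c2.symm)
    have c5 : ∫ ξ in Set.Ioc (0 : ℝ) N, ((star (φ ξ) ⬝ᵥ k ξ).re -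
        (star (g ξ) ⬝ᵥ (P1 *ᵥ b ξ)).re) = 0 := by
      refine Eq.trans ?_ ((setIntegral_eq_of_subset_of_forall_sdiff_eq_zero measurableSet_Ioi
        (Set.Ioc_subset_Ioi_self : Set.Ioc (0 : ℝ) N ⊆ Set.Ioi 0) ?_).symm.trans c4)
      · refine integral_congr_ae ?_
        filter_upwards [ae_mono (hle N) (h.ae_mulVec_inv φ)] with ξ e1
        rw [← e1, star_add, add_dotProduct, star_mulVec_dotProduct, star_mulVec_dotProduct, hP1.eq,
          hP0, neg_mulVec, dotProduct_neg]
        have e2 : (star (y ξ) ⬝ᵥ φ ξ).re = (star (φ ξ) ⬝ᵥ y ξ).re := by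
          rw [star_dotProduct, ← Complex.conj_re, starRingEnd_apply, star_star]
        rw [e2]
        simp only [k, b, dotProduct_add, Complex.add_re, Complex.neg_re]
        ring
      · rintro ξ ⟨h1, h2⟩
        have h3 : (N : ℝ) ≤ ξ := by
          by_contra hlt
          exact h2 ⟨h1, (not_le.1 hlt).le⟩
        have h4 : g ξ = 0 := hgz ξ h2
        simp [hφz ξ h3, h4]
    have k1 : IntegrableOn (fun ξ => (star (g ξ) ⬝ᵥ W ξ + star (φ ξ) ⬝ᵥ k ξ).re)
        (Set.Ioc (0 : ℝ) N) :=
      ((intervalIntegrable_iff_integrableOn_Ioc_of_le hN.le).1 (j1.add j2)).re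
    have k2 : IntegrableOn (fun ξ => (star (φ ξ) ⬝ᵥ k ξ).re - (star (g ξ) ⬝ᵥ (P1 *ᵥ b ξ)).re)
        (Set.Ioc (0 : ℝ) N) := by
      have k3 : IntegrableOn (fun ξ => (star (φ ξ) ⬝ᵥ k ξ).re) (Set.Ioc (0 : ℝ) N) :=
        ((intervalIntegrable_iff_integrableOn_Ioc_of_le hN.le).1 j2).re
      exact k3.sub (integrable_re_star_dotProduct (hg.restrict _)
        ((memLp_mulVec_const P1 hb).mono_measure (hle N)))
    have c6 := integral_sub k1 k2
    rw [c3, c5, sub_zero] at c6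
    refine Eq.trans ?_ c6
    refine integral_congr_ae (Filter.Eventually.of_forall fun ξ => ?_)
    simp only [v, dotProduct_add, Complex.add_re]
    ring
  obtain ⟨c, hc⟩ := hvconst
  have hdet := (Matrix.isUnit_iff_isUnit_det _).1 hP1inv
  have hinv : ∀ a : Fin n → ℂ, P1⁻¹ *ᵥ (P1 *ᵥ a) = a := fun a => by
    rw [mulVec_mulVec, Matrix.nonsing_inv_mul _ hdet, one_mulVec]
  have hinv' : ∀ a : Fin n → ℂ, P1 *ᵥ (P1⁻¹ *ᵥ a) = a := fun a => by
    rw [mulVec_mulVec, Matrix.mul_nonsing_inv _ hdet, one_mulVec]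
  have hrep : ∀ᵐ ξ ∂(volume.restrict (Set.Ioi (0 : ℝ))), P1⁻¹ *ᵥ (c - W ξ) = b ξ := by
    filter_upwards [hc] with ξ h1
    rw [← h1]
    simp only [v, add_sub_cancel_left]
    exact hinv _
  refine ⟨fun ξ => P1⁻¹ *ᵥ (c - W ξ), fun ξ => -(P1⁻¹ *ᵥ k ξ), hx, hy, hrep, ⟨fun N hN => ?_,
    fun ξ hξ => ?_⟩, ?_⟩
  · exact (intervalIntegrable_mulVec_const P1⁻¹ (hk N hN)).1.neg
  · rw [intervalIntegral.integral_neg, (intervalIntegrable_mulVec_const P1⁻¹ (hk ξ hξ)).2, hW0,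
      sub_zero, mulVec_sub, ← sub_eq_add_neg]
  · filter_upwards [hrep] with ξ h1
    rw [h1, mulVec_neg, neg_neg, hinv']
    simp [k]

end Adjoint

section Contraction

lemma exists_contraction_extension {np nm : ℕ} {V : Type*} [AddCommGroup V] [Module ℂ V]
    (p : V →ₗ[ℂ] (Fin np → ℂ)) (q : V →ₗ[ℂ] (Fin nm → ℂ)) {lam : Fin np → ℝ} {th : Fin nm → ℝ}
    (hlam : ∀ i, 0 < lam i) (hth : ∀ j, 0 < th j) (W : Submodule ℂ V)
    (hW : ∀ w ∈ W, ∑ i, lam i * Complex.normSq (p w i) ≤ ∑ j, th j * Complex.normSq (q w j)) :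
    ∃ T : (Fin nm → ℂ) →ₗ[ℂ] (Fin np → ℂ),
      (∀ v, (∑ i, lam i * Complex.normSq (T v i)) ≤ ∑ j, th j * Complex.normSq (v j)) ∧
        ∀ w ∈ W, T (q w) = p w := by
  let D : (Fin nm → ℂ) →ₗ[ℂ] EuclideanSpace ℂ (Fin nm) :=
    { toFun := fun z => WithLp.toLp 2 fun j => (Real.sqrt (th j) : ℂ) * z j
      map_add' := fun a b => by ext j; simp [mul_add]
      map_smul' := fun r a => by ext j; simp [mul_left_comm] }
  have hD : ∀ z, ‖D z‖ ^ 2 = ∑ j, th j * Complex.normSq (z j) := fun z => by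
    rw [EuclideanSpace.norm_sq_eq]
    refine Finset.sum_congr rfl fun j _ => ?_
    change ‖(Real.sqrt (th j) : ℂ) * z j‖ ^ 2 = _
    rw [norm_mul, mul_pow, Complex.norm_real, Real.norm_eq_abs, sq_abs, Real.sq_sqrt (hth j).le,
      Complex.sq_norm]
  let φ : W →ₗ[ℂ] EuclideanSpace ℂ (Fin nm) := (D ∘ₗ q).domRestrict W
  obtain ⟨ψ, hψ⟩ := φ.rangeRestrict.exists_rightInverse_of_surjective φ.range_rangeRestrict
  have hψ' : ∀ r : φ.range, φ (ψ r) = r := fun r =>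
    congrArg Subtype.val (LinearMap.congr_fun hψ r)
  let P : EuclideanSpace ℂ (Fin nm) →ₗ[ℂ] φ.range :=
    (φ.range.orthogonalProjectionOnto : EuclideanSpace ℂ (Fin nm) →L[ℂ] φ.range)
  refine ⟨p ∘ₗ W.subtype ∘ₗ ψ ∘ₗ P ∘ₗ D, fun v => ?_, fun w hw => ?_⟩
  · refine (hW _ (ψ (P (D v))).2).trans ?_
    rw [← hD, ← hD]
    have e : D (q (ψ (P (D v)))) = P (D v) := hψ' _
    rw [e]
    gcongr
    exact φ.range.norm_orthogonalProjectionOnto_apply_le (D v)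
  · have e1 : P (D (q w)) = ⟨φ ⟨w, hw⟩, ⟨w, hw⟩, rfl⟩ :=
      φ.range.orthogonalProjectionOnto_mem_subspace_eq_self ⟨φ ⟨w, hw⟩, ⟨w, hw⟩, rfl⟩
    have e2 : φ (ψ (P (D (q w))) - ⟨w, hw⟩) = 0 := by
      rw [map_sub, hψ', e1, sub_self]
    set r : W := ψ (P (D (q w))) - ⟨w, hw⟩ with hr
    have e3 := hW r r.2
    have e4 : D (q r) = 0 := e2
    rw [← hD, e4, norm_zero, zero_pow two_ne_zero] at e3
    have e5 : p r = 0 := by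
      ext i
      have hi := (Finset.sum_eq_zero_iff_of_nonneg
        (fun i _ => mul_nonneg (hlam i).le (Complex.normSq_nonneg _))).1
        (le_antisymm e3 (Finset.sum_nonneg fun i _ =>
          mul_nonneg (hlam i).le (Complex.normSq_nonneg _))) i (Finset.mem_univ i)
      exact Complex.normSq_eq_zero.1 ((mul_eq_zero.1 hi).resolve_left (hlam i).ne')
    have e6 : p (ψ (P (D (q w)))) - p w = 0 := by
      rw [← map_sub]
      exact e5
    exact sub_eq_zero.1 e6

lemma quadForm_conjTranspose_mul_mul {n : ℕ} (D S : Matrix (Fin n) (Fin n) ℂ) (v : Fin n → ℂ) :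
    quadForm (S.conjTranspose * D * S) v = quadForm D (S *ᵥ v) := by
  rw [quadForm, quadForm, star_mulVec_dotProduct, mulVec_mulVec, mulVec_mulVec, mul_assoc]

lemma quadForm_diagonal_append {np nm : ℕ} (lam : Fin np → ℝ) (th : Fin nm → ℝ)
    (v : Fin (np + nm) → ℂ) :
    quadForm (Matrix.diagonal
        (Fin.append (fun i => (lam i : ℂ)) (fun j => (-(th j) : ℂ)))) v =
      (∑ i, lam i * Complex.normSq (prPlus np nm v i)) -
        ∑ j, th j * Complex.normSq (prMinus np nm v j) := by
  simp only [quadForm, dotProduct, mulVec_diagonal, Pi.star_apply, Fin.sum_univ_add,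
    Fin.append_left, Fin.append_right, Complex.add_re, Complex.re_sum, prPlus, prMinus,
    sub_eq_add_neg, ← Finset.sum_neg_distrib]
  congr 1 <;> refine Finset.sum_congr rfl fun i _ => ?_
  · simp [Complex.normSq_apply]
    ring
  · simp [Complex.normSq_apply]
    ring

variable {n : ℕ} {𝓗 : ℝ → Matrix (Fin n) (Fin n) ℂ}

/-- If multiplication by an invertible constant matrix preserves `L²_𝓗`, then so does
multiplication by its inverse. -/
lemma IsWeight.memL2w_inv_mulVec_const (h : IsWeight n 𝓗) {Q : Matrix (Fin n) (Fin n) ℂ}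
    (hQ : IsUnit Q)
    (hB : ∀ f, MemL2w n 𝓗 (Set.Ioi 0) f → MemL2w n 𝓗 (Set.Ioi 0) (fun ξ => Q *ᵥ f ξ))
    {f : ℝ → Fin n → ℂ} (hf : MemL2w n 𝓗 (Set.Ioi 0) f) :
    MemL2w n 𝓗 (Set.Ioi 0) (fun ξ => Q⁻¹ *ᵥ f ξ) := by
  let B : Submodule ℂ (Matrix (Fin n) (Fin n) ℂ) :=
    { carrier := {M | ∀ f, MemL2w n 𝓗 (Set.Ioi 0) f → MemL2w n 𝓗 (Set.Ioi 0) (fun ξ => M *ᵥ f ξ)}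
      add_mem' := fun {M N} hM hN f hf => by
        simpa only [add_mulVec] using h.memL2w_add (hM f hf) (hN f hf)
      zero_mem' := fun f hf => by
        simpa using memL2w_smul 0 hf
      smul_mem' := fun c M hM f hf => by
        simpa only [smul_mulVec] using memL2w_smul c (hM f hf) }
  have hmul : ∀ M ∈ B, LinearMap.mulLeft ℂ Q M ∈ B := fun M hM f hf => by
    have := hB _ (hM f hf)
    simpa only [mulVec_mulVec, LinearMap.mulLeft_apply] using this
  have hdet := (Matrix.isUnit_iff_isUnit_det _).1 hQ
  have hinj : Function.Injective ((LinearMap.mulLeft ℂ Q).restrict hmul) := by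
    intro M N hMN
    have e : Q * M.1 = Q * N.1 := congrArg Subtype.val hMN
    exact Subtype.ext (hQ.mul_left_cancel e)
  have h1 : (1 : Matrix (Fin n) (Fin n) ℂ) ∈ B := fun f hf => by
    simpa only [one_mulVec] using hf
  obtain ⟨X, hX⟩ := LinearMap.injective_iff_surjective.1 hinj ⟨1, h1⟩
  have e : Q * X.1 = 1 := congrArg Subtype.val hX
  rw [Matrix.inv_eq_right_inv e]
  exact X.2 f hf

lemma AdjPair.memL2w_mulVec (h : IsWeight n 𝓗) {P1 P0 : Matrix (Fin n) (Fin n) ℂ}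
    {x y u g : ℝ → Fin n → ℂ} (hp : AdjPair n 𝓗 P1 P0 x y u g) :
    MemL2w n 𝓗 (Set.Ioi 0) (fun ξ => P1 *ᵥ g ξ) := by
  refine memL2w_congr (memL2w_neg (h.memL2w_add hp.right
    (h.memL2w_of_memLp (memLp_mulVec_const P0 (h.memLp_mulVec hp.left))))) ?_
  filter_upwards [hp.rep, hp.eq] with ξ h1 h2
  rw [h2, h1]
  abel

lemma AdjPair.rep_unique (h : IsWeight n 𝓗) {P1 P0 : Matrix (Fin n) (Fin n) ℂ}
    {x y u g u' g' : ℝ → Fin n → ℂ} (hp : AdjPair n 𝓗 P1 P0 x y u g)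
    (hr : RepSemi n 𝓗 x u' g') : u 0 = u' 0 := by
  refine (hp.prim.unique (hr.isPrimitive h) ?_).1
  filter_upwards [hp.rep, hr.1] with ξ h1 h2
  rw [h1, h2]

lemma AdjPair.repSemi {P1 P0 : Matrix (Fin n) (Fin n) ℂ}
    {x y u g : ℝ → Fin n → ℂ} (hp : AdjPair n 𝓗 P1 P0 x y u g)
    (hg : MemL2w n 𝓗 (Set.Ioi 0) g) : RepSemi n 𝓗 x u g :=
  ⟨hp.rep, hp.prim.eq, hg⟩

lemma IsPrimitive.mulVec (Q : Matrix (Fin n) (Fin n) ℂ) {u g : ℝ → Fin n → ℂ}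
    (hp : IsPrimitive u g) : IsPrimitive (fun ξ => Q *ᵥ u ξ) (fun ξ => Q *ᵥ g ξ) := by
  refine ⟨fun N hN => (intervalIntegrable_mulVec_const Q (hp.int N hN)).1, fun ξ hξ => ?_⟩
  rw [(intervalIntegrable_mulVec_const Q (hp.int ξ hξ)).2, hp.eq ξ hξ, mulVec_add]

end Contraction

section Main

variable {np nm : ℕ} {𝓗 : ℝ → Matrix (Fin (np + nm)) (Fin (np + nm)) ℂ}
  {P1 P0 S : Matrix (Fin (np + nm)) (Fin (np + nm)) ℂ}
  {R : (ℝ → Fin (np + nm) → ℂ) → (ℝ → Fin (np + nm) → ℂ) → Prop}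

/-- The boundary condition `T pr₋ (S a) = pr₊ (S a)`. -/
def BoundaryCond (S : Matrix (Fin (np + nm)) (Fin (np + nm)) ℂ)
    (T : (Fin nm → ℂ) →ₗ[ℂ] (Fin np → ℂ)) (a : Fin (np + nm) → ℂ) : Prop :=
  T (prMinus np nm (S *ᵥ a)) = prPlus np nm (S *ᵥ a)

lemma prPlus_add (v w : Fin (np + nm) → ℂ) :
    prPlus np nm (v + w) = prPlus np nm v + prPlus np nm w := rfl

lemma prMinus_add (v w : Fin (np + nm) → ℂ) :
    prMinus np nm (v + w) = prMinus np nm v + prMinus np nm w := rfl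

lemma prPlus_smul (c : ℂ) (v : Fin (np + nm) → ℂ) :
    prPlus np nm (c • v) = c • prPlus np nm v := rfl

lemma prMinus_smul (c : ℂ) (v : Fin (np + nm) → ℂ) :
    prMinus np nm (c • v) = c • prMinus np nm v := rfl

lemma BoundaryCond.add {T : (Fin nm → ℂ) →ₗ[ℂ] (Fin np → ℂ)} {a b : Fin (np + nm) → ℂ}
    (ha : BoundaryCond S T a) (hb : BoundaryCond S T b) : BoundaryCond S T (a + b) := by
  unfold BoundaryCond at *
  rw [mulVec_add, prMinus_add, prPlus_add, map_add, ha, hb]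

lemma BoundaryCond.smul {T : (Fin nm → ℂ) →ₗ[ℂ] (Fin np → ℂ)} {a : Fin (np + nm) → ℂ} (c : ℂ)
    (ha : BoundaryCond S T a) : BoundaryCond S T (c • a) := by
  unfold BoundaryCond at *
  rw [mulVec_smul, prMinus_smul, prPlus_smul, map_smul, ha]

lemma BoundaryCond.zero {T : (Fin nm → ℂ) →ₗ[ℂ] (Fin np → ℂ)} : BoundaryCond S T 0 := by
  simp only [BoundaryCond, mulVec_zero]
  exact map_zero T

lemma BoundaryCond.sum_le {T : (Fin nm → ℂ) →ₗ[ℂ] (Fin np → ℂ)} {lam : Fin np → ℝ}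
    {th : Fin nm → ℝ}
    (hT : ∀ v, (∑ i, lam i * Complex.normSq (T v i)) ≤ ∑ j, th j * Complex.normSq (v j))
    {a : Fin (np + nm) → ℂ} (ha : BoundaryCond S T a) :
    (∑ i, lam i * Complex.normSq (prPlus np nm (S *ᵥ a) i)) -
        ∑ j, th j * Complex.normSq (prMinus np nm (S *ᵥ a) j) ≤ 0 := by
  rw [← ha]
  exact sub_nonpos.2 (hT _)

/-- If every pair of the adjoint with vanishing boundary value has a derivative in `L²_𝓗`, then
multiplication by `P₁⁻¹` preserves `L²_𝓗`. -/
lemma IsWeight.memL2w_inv_mulVec_of_dom {n : ℕ} {𝓗 : ℝ → Matrix (Fin n) (Fin n) ℂ}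
    (h : IsWeight n 𝓗) {P1 P0 : Matrix (Fin n) (Fin n) ℂ} (hP1inv : IsUnit P1)
    (hK : ∀ x y u g, AdjPair n 𝓗 P1 P0 x y u g → u 0 = 0 → MemL2w n 𝓗 (Set.Ioi 0) g)
    {f : ℝ → Fin n → ℂ} (hf : MemL2w n 𝓗 (Set.Ioi 0) f) :
    MemL2w n 𝓗 (Set.Ioi 0) (fun ξ => P1⁻¹ *ᵥ f ξ) := by
  by_contra hnot
  obtain ⟨g, w, hg, hng, hprim, hw0, hC⟩ := h.exists_oscillating hf hnot
  have hdet := (Matrix.isUnit_iff_isUnit_det _).1 hP1inv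
  have hx := hC P1⁻¹
  have hrep := h.ae_mulVec_inv fun ξ => P1⁻¹ *ᵥ w ξ
  have hP0u : MemL2w n 𝓗 (Set.Ioi 0) (fun ξ => P0 *ᵥ (P1⁻¹ *ᵥ w ξ)) := by
    refine memL2w_congr (h.memL2w_of_memLp (memLp_mulVec_const P0 (h.memLp_mulVec hx))) ?_
    filter_upwards [hrep] with ξ h1
    rw [← h1]
  refine hng (hK _ (fun ξ => -(g ξ + P0 *ᵥ (P1⁻¹ *ᵥ w ξ))) _ _ ⟨hx,
    memL2w_neg (h.memL2w_add hg hP0u), hrep, hprim.mulVec P1⁻¹,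
    Filter.Eventually.of_forall fun ξ => ?_⟩ (by simp only [hw0, mulVec_zero]))
  simp only [mulVec_mulVec (M := P1), Matrix.mul_nonsing_inv _ hdet, one_mulVec]
  abel

/-- If `P₁ g` lies in `L²_𝓗` whenever `𝓗x` vanishes at `0` and has derivative `g ∈ L²_𝓗`, then
multiplication by `P₁` preserves `L²_𝓗`. -/
lemma IsWeight.memL2w_mulVec_of_dom {n : ℕ} {𝓗 : ℝ → Matrix (Fin n) (Fin n) ℂ}
    (h : IsWeight n 𝓗) {P1 : Matrix (Fin n) (Fin n) ℂ}
    (hK : ∀ x u g, MemL2w n 𝓗 (Set.Ioi 0) x → RepSemi n 𝓗 x u g → u 0 = 0 →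
      MemL2w n 𝓗 (Set.Ioi 0) (fun ξ => P1 *ᵥ g ξ))
    {f : ℝ → Fin n → ℂ} (hf : MemL2w n 𝓗 (Set.Ioi 0) f) :
    MemL2w n 𝓗 (Set.Ioi 0) (fun ξ => P1 *ᵥ f ξ) := by
  by_contra hnot
  obtain ⟨g, w, hg, hng, hprim, hw0, hC⟩ := h.exists_oscillating hf hnot
  have hx := hC 1
  simp only [one_mulVec] at hx
  exact hng (hK _ w g hx ⟨h.ae_mulVec_inv w, hprim.eq, hg⟩ hw0)

lemma IsWeight.maxDissipRel_of_contraction (h : IsWeight (np + nm) 𝓗)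
    (hP1 : P1.IsHermitian) (hP1inv : IsUnit P1) (hP0 : P0.conjTranspose = -P0)
    (hS : S ∈ Matrix.unitaryGroup (Fin (np + nm)) ℂ)
    {lam : Fin np → ℝ} (hlam : ∀ k, 0 < lam k) {th : Fin nm → ℝ}
    (hform : ∀ a, quadForm P1 a = (∑ i, lam i * Complex.normSq (prPlus np nm (S *ᵥ a) i)) -
      ∑ j, th j * Complex.normSq (prMinus np nm (S *ᵥ a) j))
    (hR : IsOpRel (np + nm) 𝓗 R)
    (hext : ∀ x w, GraphASemi (np + nm) 𝓗 P1 P0 x w → R x (fun ξ => -(w ξ)))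
    (hrest : ∀ x y, R x y → GraphAstarSemi (np + nm) 𝓗 P1 P0 x y)
    {T : (Fin nm → ℂ) →ₗ[ℂ] (Fin np → ℂ)}
    (hT : ∀ v, (∑ i, lam i * Complex.normSq (T v i)) ≤ ∑ j, th j * Complex.normSq (v j))
    (hdom : ∀ x : ℝ → Fin (np + nm) → ℂ, (∃ y, R x y) ↔
      (MemL2w (np + nm) 𝓗 (Set.Ioi 0) x ∧ ∃ u g, RepSemi (np + nm) 𝓗 x u g ∧
        BoundaryCond S T (u 0))) :
    MaxDissipRel (np + nm) 𝓗 R := by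
  refine ⟨fun x y hxy => ?_, fun K hK hKd hRK x y hxy => ?_⟩
  · obtain ⟨u, g, hp, -⟩ := (hrest x y hxy).exists_adjPair h
    obtain ⟨-, u', g', hr, hbc⟩ := (hdom x).1 ⟨y, hxy⟩
    rw [← hp.rep_unique h hr] at hbc
    rw [hp.green h hP1 hP0, hform]
    linarith [hbc.sum_le hT]
  · obtain ⟨u, g, hp⟩ := h.exists_adjPair_of_dissipRel hP1 hP1inv hP0 hK hKd
      (fun z w hz => hRK _ _ (hext z w hz)) hxy
    have hSS : ∀ a, S *ᵥ (S.conjTranspose *ᵥ a) = a := fun a => by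
      rw [mulVec_mulVec, ← Matrix.star_eq_conjTranspose, Matrix.mem_unitaryGroup_iff.1 hS,
        one_mulVec]
    have hbc : BoundaryCond S T (u 0) := by
      set b := prMinus np nm (S *ᵥ u 0) with hb
      obtain ⟨x₁, y₁, u₁, g₁, hp₁, hr₁, h₁⟩ := h.exists_boundary_value P1 P0
        ((-1 : ℂ) • (S.conjTranspose *ᵥ Fin.append (T b) b))
      have hpl : prPlus np nm (Fin.append (T b) b) = T b := by
        ext i
        simp [prPlus]
      have hmi : prMinus np nm (Fin.append (T b) b) = b := by
        ext i
        simp [prMinus]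
      have hb₁ : BoundaryCond S T (u₁ 0) := by
        rw [h₁]
        refine BoundaryCond.smul _ ?_
        rw [BoundaryCond, hSS, hpl, hmi]
      obtain ⟨y₂, hR₂⟩ := (hdom x₁).2 ⟨hp₁.left, u₁, g₁, hr₁, hb₁⟩
      obtain ⟨u₂, g₂, hp₂, -⟩ := (hrest _ _ hR₂).exists_adjPair h
      have h₂ := (hp₂.rep_unique h hr₁).trans h₁
      have hneg := hKd _ _ (hK.2.2.1 _ _ _ _ hxy (hRK _ _ hR₂))
      rw [(hp.add h hp₂).green h hP1 hP0, hform, h₂, mulVec_add, mulVec_smul, hSS, prPlus_add,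
        prMinus_add, prPlus_smul, prMinus_smul, hpl, hmi, ← hb] at hneg
      have hz : ∑ j, th j * Complex.normSq ((b + (-1 : ℂ) • b) j) = 0 := by simp
      rw [hz, sub_zero] at hneg
      refine funext fun i => ?_
      have hnn : ∀ i ∈ Finset.univ, 0 ≤ lam i * Complex.normSq
          ((prPlus np nm (S *ᵥ u 0) + (-1 : ℂ) • T b) i) :=
        fun i _ => mul_nonneg (hlam i).le (Complex.normSq_nonneg _)
      have hi := (Finset.sum_eq_zero_iff_of_nonneg hnn).1
        (le_antisymm (by linarith) (Finset.sum_nonneg hnn)) i (Finset.mem_univ i)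
      have hi' := Complex.normSq_eq_zero.1 ((mul_eq_zero.1 hi).resolve_left (hlam i).ne')
      simp only [Pi.add_apply, neg_one_smul] at hi'
      exact (sub_eq_zero.1 hi').symm
    have hdet := (Matrix.isUnit_iff_isUnit_det _).1 hP1inv
    have hB : ∀ f, MemL2w (np + nm) 𝓗 (Set.Ioi 0) f →
        MemL2w (np + nm) 𝓗 (Set.Ioi 0) (fun ξ => P1 *ᵥ f ξ) := fun f hf => by
      refine h.memL2w_mulVec_of_dom (fun x u g hx hr hu0 => ?_) hf
      obtain ⟨y, hRy⟩ := (hdom x).2 ⟨hx, u, g, hr, hu0 ▸ BoundaryCond.zero⟩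
      obtain ⟨u', g', hp', -⟩ := (hrest _ _ hRy).exists_adjPair h
      refine memL2w_congr (hp'.memL2w_mulVec h) ?_
      have huu : u =ᵐ[volume.restrict (Set.Ioi 0)] u' := by
        filter_upwards [hr.1, hp'.rep] with ξ e1 e2
        rw [e1, e2]
      filter_upwards [((hr.isPrimitive h).unique hp'.prim huu).2] with ξ e1
      rw [e1]
    have hg : MemL2w (np + nm) 𝓗 (Set.Ioi 0) g := by
      refine memL2w_congr (h.memL2w_inv_mulVec_const hP1inv hB (hp.memL2w_mulVec h)) ?_
      refine Filter.Eventually.of_forall fun ξ => ?_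
      simp only [mulVec_mulVec, Matrix.nonsing_inv_mul _ hdet, one_mulVec]
    obtain ⟨y', hRy⟩ := (hdom x).2 ⟨hp.left, u, g, hp.repSemi hg, hbc⟩
    exact hR.2.1 _ _ _ _ hRy (Filter.EventuallyEq.refl _ _)
      (hK.2.2.2.2 _ _ _ hxy (hRK _ _ hRy))

lemma IsWeight.exists_contraction_of_maxDissipRel (h : IsWeight (np + nm) 𝓗)
    (hP1 : P1.IsHermitian) (hP1inv : IsUnit P1) (hP0 : P0.conjTranspose = -P0)
    {lam : Fin np → ℝ} (hlam : ∀ k, 0 < lam k) {th : Fin nm → ℝ} (hth : ∀ j, 0 < th j)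
    (hform : ∀ a, quadForm P1 a = (∑ i, lam i * Complex.normSq (prPlus np nm (S *ᵥ a) i)) -
      ∑ j, th j * Complex.normSq (prMinus np nm (S *ᵥ a) j))
    (hR : IsOpRel (np + nm) 𝓗 R)
    (hext : ∀ x w, GraphASemi (np + nm) 𝓗 P1 P0 x w → R x (fun ξ => -(w ξ)))
    (hrest : ∀ x y, R x y → GraphAstarSemi (np + nm) 𝓗 P1 P0 x y)
    (hmax : MaxDissipRel (np + nm) 𝓗 R) :
    ∃ T : (Fin nm → ℂ) →ₗ[ℂ] (Fin np → ℂ),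
      (∀ v, (∑ i, lam i * Complex.normSq (T v i)) ≤ ∑ j, th j * Complex.normSq (v j)) ∧
        ∀ x : ℝ → Fin (np + nm) → ℂ, (∃ y, R x y) ↔
          (MemL2w (np + nm) 𝓗 (Set.Ioi 0) x ∧ ∃ u g, RepSemi (np + nm) 𝓗 x u g ∧
            BoundaryCond S T (u 0)) := by
  have hzero : GraphASemi (np + nm) 𝓗 P1 P0 (fun _ => 0) (fun _ => 0) := by
    have h0 : MemL2w (np + nm) 𝓗 (Set.Ioi 0) (fun _ => 0) :=
      h.memL2w_of_memLp MemLp.zero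
    refine ⟨h0, h0, fun _ => 0, fun _ => 0, ⟨?_, ?_, h0⟩, rfl, ?_⟩ <;> simp
  let W : Submodule ℂ (Fin (np + nm) → ℂ) :=
    { carrier := {a | ∃ x y u g, R x y ∧ AdjPair (np + nm) 𝓗 P1 P0 x y u g ∧ u 0 = a}
      add_mem' := by
        rintro _ _ ⟨x, y, u, g, hxy, hp, rfl⟩ ⟨x', y', u', g', hxy', hp', rfl⟩
        exact ⟨_, _, _, _, hR.2.2.1 _ _ _ _ hxy hxy', hp.add h hp', rfl⟩
      zero_mem' := by
        obtain ⟨u, g, hp, hu0⟩ := hzero.exists_adjPair h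
        exact ⟨_, _, u, g, hext _ _ hzero, hp, hu0⟩
      smul_mem' := by
        rintro c _ ⟨x, y, u, g, hxy, hp, rfl⟩
        exact ⟨_, _, _, _, hR.2.2.2.1 c _ _ hxy, hp.smul c, rfl⟩ }
  obtain ⟨T, hT, hTW⟩ := exists_contraction_extension
    (LinearMap.funLeft ℂ ℂ (Fin.castAdd nm) ∘ₗ S.mulVecLin)
    (LinearMap.funLeft ℂ ℂ (Fin.natAdd np) ∘ₗ S.mulVecLin) hlam hth W (by
      rintro _ ⟨x, y, u, g, hxy, hp, rfl⟩
      have h1 := hmax.1 _ _ hxy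
      rw [hp.green h hP1 hP0, hform] at h1
      change ∑ i, lam i * Complex.normSq (prPlus np nm (S *ᵥ u 0) i) ≤
        ∑ j, th j * Complex.normSq (prMinus np nm (S *ᵥ u 0) j)
      linarith)
  have hbc : ∀ x y u g, R x y → AdjPair (np + nm) 𝓗 P1 P0 x y u g → BoundaryCond S T (u 0) :=
    fun x y u g hxy hp => hTW (u 0) ⟨x, y, u, g, hxy, hp, rfl⟩
  have hKR : ∀ x y u g, AdjPair (np + nm) 𝓗 P1 P0 x y u g → BoundaryCond S T (u 0) → R x y := by
    let K : (ℝ → Fin (np + nm) → ℂ) → (ℝ → Fin (np + nm) → ℂ) → Prop := fun x y =>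
      ∃ u g, AdjPair (np + nm) 𝓗 P1 P0 x y u g ∧ BoundaryCond S T (u 0)
    have hKop : IsOpRel (np + nm) 𝓗 K := by
      refine ⟨?_, ?_, ?_, ?_, ?_⟩
      · rintro x y ⟨u, g, hp, -⟩
        exact ⟨hp.left, hp.right⟩
      · rintro x y x' y' ⟨u, g, hp, hb⟩ hx hy
        exact ⟨u, g, hp.congr hx hy, hb⟩
      · rintro x y x' y' ⟨u, g, hp, hb⟩ ⟨u', g', hp', hb'⟩
        exact ⟨_, _, hp.add h hp', hb.add hb'⟩
      · rintro c x y ⟨u, g, hp, hb⟩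
        exact ⟨_, _, hp.smul c, hb.smul c⟩
      · rintro x y y' ⟨u, g, hp, -⟩ ⟨u', g', hp', -⟩
        exact (hp.unique hp' (Filter.EventuallyEq.refl _ _)).2.2
    have hKd : DissipRel (np + nm) 𝓗 K := by
      rintro x y ⟨u, g, hp, hb⟩
      rw [hp.green h hP1 hP0, hform]
      linarith [hb.sum_le hT]
    intro x y u g hp hb
    refine hmax.2 K hKop hKd (fun x y hxy => ?_) x y ⟨u, g, hp, hb⟩
    obtain ⟨u, g, hp, -⟩ := (hrest _ _ hxy).exists_adjPair h
    exact ⟨u, g, hp, hbc _ _ _ _ hxy hp⟩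
  refine ⟨T, hT, fun x => ⟨?_, ?_⟩⟩
  · rintro ⟨y, hxy⟩
    obtain ⟨u, g, hp, hg⟩ := (hrest _ _ hxy).exists_adjPair h
    exact ⟨hp.left, u, g, hp.repSemi hg, hbc _ _ _ _ hxy hp⟩
  · rintro ⟨hx, u, g, hr, hb⟩
    have hBinv : ∀ f, MemL2w (np + nm) 𝓗 (Set.Ioi 0) f →
        MemL2w (np + nm) 𝓗 (Set.Ioi 0) (fun ξ => P1⁻¹ *ᵥ f ξ) := fun f hf => by
      refine h.memL2w_inv_mulVec_of_dom (P0 := P0) hP1inv (fun x y u g hp hu0 => ?_) hf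
      obtain ⟨u', g', hp', hg'⟩ :=
        (hrest _ _ (hKR x y u g hp (hu0 ▸ BoundaryCond.zero))).exists_adjPair h
      exact memL2w_congr hg' (hp.unique hp' (Filter.EventuallyEq.refl _ _)).2.1
    have hPg := h.memL2w_inv_mulVec_const (Matrix.isUnit_nonsing_inv_iff.2 hP1inv) hBinv hr.2.2
    rw [Matrix.nonsing_inv_nonsing_inv _ ((Matrix.isUnit_iff_isUnit_det _).1 hP1inv)] at hPg
    have hy : MemL2w (np + nm) 𝓗 (Set.Ioi 0) (fun ξ => -(P1 *ᵥ g ξ) - P0 *ᵥ (𝓗 ξ *ᵥ x ξ)) := by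
      simpa only [sub_eq_add_neg] using h.memL2w_add (memL2w_neg hPg)
        (memL2w_neg (h.memL2w_of_memLp (memLp_mulVec_const P0 (h.memLp_mulVec hx))))
    refine ⟨_, hKR x _ u g ⟨hx, hy, hr.1, hr.isPrimitive h, ?_⟩ hb⟩
    filter_upwards [hr.1] with ξ e1
    rw [e1]

end Main

/-- **classification of contraction generators on the semi-axis.** In the
semi-axis boundary-system setting, a linear operator `H` (given as a relation `R`) with
`−A ⊆ H ⊆ A*` is maximal dissipative in `L²_𝓗(0, ∞)` — equivalently, it generates a
`C₀`-semigroup of contractions — if and only if there is a linear contraction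
`T : G₂ → G₁` (i.e. `(Tz)*Λ(Tz) ≤ z*Θz`) such that
`D(H) = {x : (𝓗x)' ∈ L²_𝓗 and T pr₋(S(𝓗x)(0)) = pr₊(S(𝓗x)(0))}`. -/
theorem stmt_15 (np nm : ℕ) (hd : 1 ≤ np + nm)
    (𝓗 : ℝ → Matrix (Fin (np + nm)) (Fin (np + nm)) ℂ)
    (hmeas : ∀ i j, AEMeasurable (fun ξ => 𝓗 ξ i j) (volume.restrict (Set.Ioi 0)))
    (hherm : ∀ᵐ ξ ∂(volume.restrict (Set.Ioi 0)), (𝓗 ξ).IsHermitian)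
    (hloc : ∀ K : Set ℝ, Bornology.IsBounded K → ∃ m M : ℝ, 0 < m ∧ 0 < M ∧
      ∀ᵐ ξ ∂(volume.restrict (K ∩ Set.Ioi 0)), ∀ ζ : Fin (np + nm) → ℂ,
        m * (star ζ ⬝ᵥ ζ).re ≤ (star ζ ⬝ᵥ ((𝓗 ξ) *ᵥ ζ)).re ∧
          (star ζ ⬝ᵥ ((𝓗 ξ) *ᵥ ζ)).re ≤ M * (star ζ ⬝ᵥ ζ).re)
    (hbdd : ∃ M : ℝ, ∀ᵐ ξ ∂(volume.restrict (Set.Ioi 0)), ∀ ζ : Fin (np + nm) → ℂ,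
      (star ζ ⬝ᵥ ((𝓗 ξ) *ᵥ ζ)).re ≤ M * (star ζ ⬝ᵥ ζ).re)
    (P1 P0 S : Matrix (Fin (np + nm)) (Fin (np + nm)) ℂ)
    (hP1 : P1.IsHermitian) (hP1inv : IsUnit P1) (hP0 : P0.conjTranspose = -P0)
    (hS : S ∈ Matrix.unitaryGroup (Fin (np + nm)) ℂ)
    (lam : Fin np → ℝ) (hlam : ∀ k, 0 < lam k)
    (th : Fin nm → ℝ) (hth : ∀ j, 0 < th j)
    (hdiag : P1 = S.conjTranspose *
      Matrix.diagonal (Fin.append (fun i => (lam i : ℂ)) (fun j => (-(th j) : ℂ))) * S)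
    (R : (ℝ → Fin (np + nm) → ℂ) → (ℝ → Fin (np + nm) → ℂ) → Prop)
    (hR : IsOpRel (np + nm) 𝓗 R)
    (hext : ∀ x w, GraphASemi (np + nm) 𝓗 P1 P0 x w → R x (fun ξ => -(w ξ)))
    (hrest : ∀ x y, R x y → GraphAstarSemi (np + nm) 𝓗 P1 P0 x y) :
    MaxDissipRel (np + nm) 𝓗 R ↔
      ∃ T : (Fin nm → ℂ) →ₗ[ℂ] (Fin np → ℂ),
        (∀ v : Fin nm → ℂ,
          (∑ i, lam i * Complex.normSq (T v i)) ≤ ∑ j, th j * Complex.normSq (v j)) ∧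
        ∀ x : ℝ → Fin (np + nm) → ℂ,
          (∃ y, R x y) ↔
            (MemL2w (np + nm) 𝓗 (Set.Ioi 0) x ∧ ∃ u g, RepSemi (np + nm) 𝓗 x u g ∧
              T (prMinus np nm (S *ᵥ (u 0))) = prPlus np nm (S *ᵥ (u 0))) := by
  have h : IsWeight (np + nm) 𝓗 := by
    refine ⟨hmeas, hherm, fun N => ?_, ?_⟩
    · obtain ⟨m, M, hm, -, hb⟩ := hloc (Set.Icc 0 N) (Metric.isBounded_Icc 0 N)
      refine ⟨m, hm, ?_⟩
      rw [ae_restrict_iff' (measurableSet_Icc.inter measurableSet_Ioi)] at hb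
      rw [ae_restrict_iff' measurableSet_Ioi]
      filter_upwards [hb] with ξ h1 h2 h3 ζ
      exact (h1 ⟨⟨le_of_lt h2, h3⟩, h2⟩ ζ).1
    · obtain ⟨M, hM⟩ := hbdd
      refine ⟨max M 1, by positivity, ?_⟩
      filter_upwards [hM] with ξ h1 ζ
      refine (h1 ζ).trans ?_
      have h2 : 0 ≤ (star ζ ⬝ᵥ ζ).re := (sq_nonneg _).trans (sq_norm_le_dotProduct_self ζ)
      gcongr
      exact le_max_left _ _
  have hform : ∀ a, quadForm P1 a =
      (∑ i, lam i * Complex.normSq (prPlus np nm (S *ᵥ a) i)) -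
        ∑ j, th j * Complex.normSq (prMinus np nm (S *ᵥ a) j) := fun a => by
    rw [hdiag, quadForm_conjTranspose_mul_mul, quadForm_diagonal_append]
  refine ⟨fun hmax => h.exists_contraction_of_maxDissipRel hP1 hP1inv hP0 hlam hth hform hR hext
    hrest hmax, ?_⟩
  rintro ⟨T, hT, hdom⟩
  exact h.maxDissipRel_of_contraction hP1 hP1inv hP0 hS hlam hform hR hext hrest hT hdom
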